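/- Soundness and full completeness of the call-by-name translation into EEC: (1) if Θ ⊢ M =_{βη} N : τ then Θⁿ ⊢ Mⁿ = Nⁿ : τⁿ in the equational theory of EEC; (2) if Θ ⊢ M, N : τ are simply-typed terms and Θⁿ ⊢ Mⁿ = Nⁿ : τⁿ in EEC, then Θ ⊢ M =_{βη} N : τ; (3) if Θⁿ ⊢ t : τⁿ is derivable in EEC, then there exists a simply-typed term Θ ⊢ M : τ such that Θⁿ ⊢ Mⁿ = t : τⁿ in EEC. -/

import Mathlib

set_option autoImplicit false

namespace EEC

/-! # The enriched effect calculus (EEC)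

A deep embedding of the enriched effect calculus of Egger, Møgelberg and
Simpson: value types and computation types, raw terms (de Bruijn indices for
value variables, together with a designated stoup variable `svar`), typing
derivations with an (at most singleton) stoup, the βη-equational theory, the
simply-typed λ-calculus together with βη-equality and Moggi's computational
λ-calculus equality, the standard cbv/cbn translations of typed λ-calculus
into EEC, Hasegawa's linear-use CPS translations, and the generic linear-use
CPS self-translation of EEC. -/

mutual
  /-- Value types of EEC. -/
  inductive VType : Type
    | base : ℕ → VType                 -- value type constants α
    | unit : VType                     -- 1
    | prod : VType → VType → VType     -- A × B
    | arr : VType → VType → VType      -- A → B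
    | comp : CType → VType             -- every computation type is a value type
    | lin : CType → CType → VType      -- A̲ ⊸ B̲
  /-- Computation types of EEC. -/
  inductive CType : Type
    | base : ℕ → CType                 -- computation type constants α̲
    | cunit : CType                    -- 1̲
    | cand : CType → CType → CType     -- A̲ & B̲
    | carr : VType → CType → CType     -- A ⇒ B̲
    | iunit : CType                    -- I̲
    | bang : VType → CType             -- !A
    | copow : VType → CType → CType    -- !A ⊗ B̲
    | czero : CType                    -- 0̲
    | csum : CType → CType → CType     -- A̲ ⊕ B̲
end

/-- Raw terms of EEC.  Value variables are de Bruijn indices (`var n`, with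
`var 0` the innermost bound variable); the unique stoup variable is `svar`
(the constructs `llam`, `copowlet` (in its body) and `ccase` (in its
branches) bind the stoup variable). -/
inductive Tm : Type
  | var : ℕ → Tm                -- value variable
  | svar : Tm                   -- the stoup variable
  | unit : Tm                   -- * : 1
  | vpair : Tm → Tm → Tm        -- ⟨t,u⟩
  | vfst : Tm → Tm
  | vsnd : Tm → Tm
  | vlam : VType → Tm → Tm      -- λx:A. t
  | vapp : Tm → Tm → Tm
  | cunit : Tm                  -- ⋆ : 1̲
  | cpair : Tm → Tm → Tm        -- ⟨t,u⟩ : A̲ & B̲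
  | cfst : Tm → Tm
  | csnd : Tm → Tm
  | clam : VType → Tm → Tm      -- λx:A ⇒ t
  | capp : Tm → Tm → Tm         -- s ⋅ t
  | top : Tm                    -- ⊤ : I̲
  | ilet : Tm → Tm → Tm         -- t to ⊤. u
  | bang : Tm → Tm              -- !t
  | banglet : Tm → Tm → Tm      -- let !x = t in u   (binds a value variable in u)
  | copow : Tm → Tm → Tm        -- !t ⊗ u
  | copowlet : Tm → Tm → Tm     -- let !x⊗y = s in t (binds a value variable and the stoup variable in t)
  | cimage : CType → Tm → Tm    -- image_{A̲}(t)
  | cinl : Tm → Tm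
  | cinr : Tm → Tm
  | ccase : Tm → Tm → Tm → Tm   -- case s of (x. t | y. u)  (branches bind the stoup variable)
  | llam : CType → Tm → Tm      -- λ°z:A̲. t (binds the stoup variable)
  | lapp : Tm → Tm → Tm         -- s[t]

namespace Tm

/-- Lift a renaming of value variables under a binder. -/
def liftN (f : ℕ → ℕ) : ℕ → ℕ
  | 0 => 0
  | n + 1 => f n + 1

/-- Renaming of value variables. -/
def rename (f : ℕ → ℕ) : Tm → Tm
  | .var n => .var (f n)
  | .svar => .svar
  | .unit => .unit
  | .vpair t u => .vpair (rename f t) (rename f u)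
  | .vfst t => .vfst (rename f t)
  | .vsnd t => .vsnd (rename f t)
  | .vlam A t => .vlam A (rename (liftN f) t)
  | .vapp s t => .vapp (rename f s) (rename f t)
  | .cunit => .cunit
  | .cpair t u => .cpair (rename f t) (rename f u)
  | .cfst t => .cfst (rename f t)
  | .csnd t => .csnd (rename f t)
  | .clam A t => .clam A (rename (liftN f) t)
  | .capp s t => .capp (rename f s) (rename f t)
  | .top => .top
  | .ilet t u => .ilet (rename f t) (rename f u)
  | .bang t => .bang (rename f t)
  | .banglet t u => .banglet (rename f t) (rename (liftN f) u)
  | .copow t u => .copow (rename f t) (rename f u)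
  | .copowlet s t => .copowlet (rename f s) (rename (liftN f) t)
  | .cimage A t => .cimage A (rename f t)
  | .cinl t => .cinl (rename f t)
  | .cinr t => .cinr (rename f t)
  | .ccase s t u => .ccase (rename f s) (rename f t) (rename f u)
  | .llam A t => .llam A (rename f t)
  | .lapp s t => .lapp (rename f s) (rename f t)

/-- Weakening of value variables. -/
def shift (t : Tm) : Tm := rename Nat.succ t

/-- Lift a parallel substitution of value variables under a binder. -/
def liftS (σ : ℕ → Tm) : ℕ → Tm
  | 0 => .var 0
  | n + 1 => shift (σ n)

/-- Parallel (capture-avoiding) substitution for value variables. -/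
def psubst (σ : ℕ → Tm) : Tm → Tm
  | .var n => σ n
  | .svar => .svar
  | .unit => .unit
  | .vpair t u => .vpair (psubst σ t) (psubst σ u)
  | .vfst t => .vfst (psubst σ t)
  | .vsnd t => .vsnd (psubst σ t)
  | .vlam A t => .vlam A (psubst (liftS σ) t)
  | .vapp s t => .vapp (psubst σ s) (psubst σ t)
  | .cunit => .cunit
  | .cpair t u => .cpair (psubst σ t) (psubst σ u)
  | .cfst t => .cfst (psubst σ t)
  | .csnd t => .csnd (psubst σ t)
  | .clam A t => .clam A (psubst (liftS σ) t)
  | .capp s t => .capp (psubst σ s) (psubst σ t)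
  | .top => .top
  | .ilet t u => .ilet (psubst σ t) (psubst σ u)
  | .bang t => .bang (psubst σ t)
  | .banglet t u => .banglet (psubst σ t) (psubst (liftS σ) u)
  | .copow t u => .copow (psubst σ t) (psubst σ u)
  | .copowlet s t => .copowlet (psubst σ s) (psubst (liftS σ) t)
  | .cimage A t => .cimage A (psubst σ t)
  | .cinl t => .cinl (psubst σ t)
  | .cinr t => .cinr (psubst σ t)
  | .ccase s t u => .ccase (psubst σ s) (psubst σ t) (psubst σ u)
  | .llam A t => .llam A (psubst σ t)
  | .lapp s t => .lapp (psubst σ s) (psubst σ t)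

/-- Capture-avoiding substitution `t[u/x]` of a term `u` for the innermost
value variable of `t`. -/
def subst0 (u : Tm) (t : Tm) : Tm :=
  psubst (fun n => match n with | 0 => u | m + 1 => .var m) t

/-- Capture-avoiding substitution `t[u/z]` of a term `u` for the stoup
variable of `t`.  The substitution stops at the stoup-variable binders
(`llam`-bodies, `copowlet`-bodies and `ccase`-branches). -/
def ssubst (u : Tm) : Tm → Tm
  | .var n => .var n
  | .svar => u
  | .unit => .unit
  | .vpair t t' => .vpair (ssubst u t) (ssubst u t')
  | .vfst t => .vfst (ssubst u t)
  | .vsnd t => .vsnd (ssubst u t)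
  | .vlam A t => .vlam A (ssubst (shift u) t)
  | .vapp s t => .vapp (ssubst u s) (ssubst u t)
  | .cunit => .cunit
  | .cpair t t' => .cpair (ssubst u t) (ssubst u t')
  | .cfst t => .cfst (ssubst u t)
  | .csnd t => .csnd (ssubst u t)
  | .clam A t => .clam A (ssubst (shift u) t)
  | .capp s t => .capp (ssubst u s) (ssubst u t)
  | .top => .top
  | .ilet t t' => .ilet (ssubst u t) (ssubst u t')
  | .bang t => .bang (ssubst u t)
  | .banglet t t' => .banglet (ssubst u t) (ssubst (shift u) t')
  | .copow t t' => .copow (ssubst u t) (ssubst u t')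
  | .copowlet s t => .copowlet (ssubst u s) t
  | .cimage A t => .cimage A (ssubst u t)
  | .cinl t => .cinl (ssubst u t)
  | .cinr t => .cinr (ssubst u t)
  | .ccase s t t' => .ccase (ssubst u s) t t'
  | .llam A t => .llam A t
  | .lapp s t => .lapp (ssubst u s) (ssubst u t)

end Tm

/-- Typing derivations of EEC (Figure 1 of the paper).  `Deriv Γ none t A`
is the judgement `Γ ⊢ t : A` (empty stoup); `Deriv Γ (some A̲) t (.comp B̲)`
is the judgement `Γ | z:A̲ ⊢ t : B̲`.  In the rules below `Δ` ranges over an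
arbitrary (possibly empty) stoup. -/
inductive Deriv : List VType → Option CType → Tm → VType → Type
  | var (Γ : List VType) (n : ℕ) (A : VType) :
      Γ[n]? = some A → Deriv Γ none (.var n) A
  | svar (Γ : List VType) (A : CType) : Deriv Γ (some A) .svar (.comp A)
  | unit (Γ : List VType) : Deriv Γ none .unit .unit
  | vpair (Γ : List VType) (t u : Tm) (A B : VType) :
      Deriv Γ none t A → Deriv Γ none u B → Deriv Γ none (.vpair t u) (.prod A B)
  | vfst (Γ : List VType) (t : Tm) (A B : VType) :
      Deriv Γ none t (.prod A B) → Deriv Γ none (.vfst t) A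
  | vsnd (Γ : List VType) (t : Tm) (A B : VType) :
      Deriv Γ none t (.prod A B) → Deriv Γ none (.vsnd t) B
  | vlam (Γ : List VType) (t : Tm) (A B : VType) :
      Deriv (A :: Γ) none t B → Deriv Γ none (.vlam A t) (.arr A B)
  | vapp (Γ : List VType) (s t : Tm) (A B : VType) :
      Deriv Γ none s (.arr A B) → Deriv Γ none t A → Deriv Γ none (.vapp s t) B
  | cunit (Γ : List VType) (Δ : Option CType) : Deriv Γ Δ .cunit (.comp .cunit)
  | cpair (Γ : List VType) (Δ : Option CType) (t u : Tm) (A B : CType) :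
      Deriv Γ Δ t (.comp A) → Deriv Γ Δ u (.comp B) →
      Deriv Γ Δ (.cpair t u) (.comp (.cand A B))
  | cfst (Γ : List VType) (Δ : Option CType) (t : Tm) (A B : CType) :
      Deriv Γ Δ t (.comp (.cand A B)) → Deriv Γ Δ (.cfst t) (.comp A)
  | csnd (Γ : List VType) (Δ : Option CType) (t : Tm) (A B : CType) :
      Deriv Γ Δ t (.comp (.cand A B)) → Deriv Γ Δ (.csnd t) (.comp B)
  | clam (Γ : List VType) (Δ : Option CType) (t : Tm) (A : VType) (B : CType) :
      Deriv (A :: Γ) Δ t (.comp B) → Deriv Γ Δ (.clam A t) (.comp (.carr A B))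
  | capp (Γ : List VType) (Δ : Option CType) (s t : Tm) (A : VType) (B : CType) :
      Deriv Γ Δ s (.comp (.carr A B)) → Deriv Γ none t A →
      Deriv Γ Δ (.capp s t) (.comp B)
  | top (Γ : List VType) : Deriv Γ none .top (.comp .iunit)
  | ilet (Γ : List VType) (Δ : Option CType) (t u : Tm) (A : CType) :
      Deriv Γ Δ t (.comp .iunit) → Deriv Γ none u (.comp A) →
      Deriv Γ Δ (.ilet t u) (.comp A)
  | bang (Γ : List VType) (t : Tm) (A : VType) :
      Deriv Γ none t A → Deriv Γ none (.bang t) (.comp (.bang A))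
  | banglet (Γ : List VType) (Δ : Option CType) (t u : Tm) (A : VType) (B : CType) :
      Deriv Γ Δ t (.comp (.bang A)) → Deriv (A :: Γ) none u (.comp B) →
      Deriv Γ Δ (.banglet t u) (.comp B)
  | copow (Γ : List VType) (Δ : Option CType) (t u : Tm) (A : VType) (B : CType) :
      Deriv Γ none t A → Deriv Γ Δ u (.comp B) →
      Deriv Γ Δ (.copow t u) (.comp (.copow A B))
  | copowlet (Γ : List VType) (Δ : Option CType) (s t : Tm) (A : VType) (B C : CType) :
      Deriv Γ Δ s (.comp (.copow A B)) → Deriv (A :: Γ) (some B) t (.comp C) →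
      Deriv Γ Δ (.copowlet s t) (.comp C)
  | cimage (Γ : List VType) (Δ : Option CType) (t : Tm) (A : CType) :
      Deriv Γ Δ t (.comp .czero) → Deriv Γ Δ (.cimage A t) (.comp A)
  | cinl (Γ : List VType) (Δ : Option CType) (t : Tm) (A B : CType) :
      Deriv Γ Δ t (.comp A) → Deriv Γ Δ (.cinl t) (.comp (.csum A B))
  | cinr (Γ : List VType) (Δ : Option CType) (t : Tm) (A B : CType) :
      Deriv Γ Δ t (.comp B) → Deriv Γ Δ (.cinr t) (.comp (.csum A B))
  | ccase (Γ : List VType) (Δ : Option CType) (s t u : Tm) (A B C : CType) :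
      Deriv Γ Δ s (.comp (.csum A B)) → Deriv Γ (some A) t (.comp C) →
      Deriv Γ (some B) u (.comp C) → Deriv Γ Δ (.ccase s t u) (.comp C)
  | llam (Γ : List VType) (t : Tm) (A B : CType) :
      Deriv Γ (some A) t (.comp B) → Deriv Γ none (.llam A t) (.lin A B)
  | lapp (Γ : List VType) (Δ : Option CType) (s t : Tm) (A B : CType) :
      Deriv Γ none s (.lin A B) → Deriv Γ Δ t (.comp A) →
      Deriv Γ Δ (.lapp s t) (.comp B)

/-- The equational theory of EEC: the smallest type-respecting congruence
containing the βη-equalities of Figure 2 of the paper. -/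
inductive EEq : List VType → Option CType → Tm → Tm → VType → Prop
  -- equivalence
  | refl {Γ Δ t A} : Deriv Γ Δ t A → EEq Γ Δ t t A
  | symm {Γ Δ t u A} : EEq Γ Δ t u A → EEq Γ Δ u t A
  | trans {Γ Δ t u v A} : EEq Γ Δ t u A → EEq Γ Δ u v A → EEq Γ Δ t v A
  -- congruence rules
  | vpair_cong {Γ t t' u u' A B} : EEq Γ none t t' A → EEq Γ none u u' B →
      EEq Γ none (.vpair t u) (.vpair t' u') (.prod A B)
  | vfst_cong {Γ t t' A B} : EEq Γ none t t' (.prod A B) →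
      EEq Γ none (.vfst t) (.vfst t') A
  | vsnd_cong {Γ t t' A B} : EEq Γ none t t' (.prod A B) →
      EEq Γ none (.vsnd t) (.vsnd t') B
  | vlam_cong {Γ t t' A B} : EEq (A :: Γ) none t t' B →
      EEq Γ none (.vlam A t) (.vlam A t') (.arr A B)
  | vapp_cong {Γ s s' t t' A B} : EEq Γ none s s' (.arr A B) → EEq Γ none t t' A →
      EEq Γ none (.vapp s t) (.vapp s' t') B
  | cpair_cong {Γ Δ t t' u u' A B} : EEq Γ Δ t t' (.comp A) → EEq Γ Δ u u' (.comp B) →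
      EEq Γ Δ (.cpair t u) (.cpair t' u') (.comp (.cand A B))
  | cfst_cong {Γ Δ t t' A B} : EEq Γ Δ t t' (.comp (.cand A B)) →
      EEq Γ Δ (.cfst t) (.cfst t') (.comp A)
  | csnd_cong {Γ Δ t t' A B} : EEq Γ Δ t t' (.comp (.cand A B)) →
      EEq Γ Δ (.csnd t) (.csnd t') (.comp B)
  | clam_cong {Γ Δ t t' A B} : EEq (A :: Γ) Δ t t' (.comp B) →
      EEq Γ Δ (.clam A t) (.clam A t') (.comp (.carr A B))
  | capp_cong {Γ Δ s s' t t' A B} : EEq Γ Δ s s' (.comp (.carr A B)) → EEq Γ none t t' A →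
      EEq Γ Δ (.capp s t) (.capp s' t') (.comp B)
  | ilet_cong {Γ Δ t t' u u' A} : EEq Γ Δ t t' (.comp .iunit) → EEq Γ none u u' (.comp A) →
      EEq Γ Δ (.ilet t u) (.ilet t' u') (.comp A)
  | bang_cong {Γ t t' A} : EEq Γ none t t' A →
      EEq Γ none (.bang t) (.bang t') (.comp (.bang A))
  | banglet_cong {Γ Δ t t' u u' A B} : EEq Γ Δ t t' (.comp (.bang A)) →
      EEq (A :: Γ) none u u' (.comp B) →
      EEq Γ Δ (.banglet t u) (.banglet t' u') (.comp B)
  | copow_cong {Γ Δ t t' u u' A B} : EEq Γ none t t' A → EEq Γ Δ u u' (.comp B) →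
      EEq Γ Δ (.copow t u) (.copow t' u') (.comp (.copow A B))
  | copowlet_cong {Γ Δ s s' t t' A B C} : EEq Γ Δ s s' (.comp (.copow A B)) →
      EEq (A :: Γ) (some B) t t' (.comp C) →
      EEq Γ Δ (.copowlet s t) (.copowlet s' t') (.comp C)
  | cimage_cong {Γ Δ t t' A} : EEq Γ Δ t t' (.comp .czero) →
      EEq Γ Δ (.cimage A t) (.cimage A t') (.comp A)
  | cinl_cong {Γ Δ t t' A B} : EEq Γ Δ t t' (.comp A) →
      EEq Γ Δ (.cinl t) (.cinl t') (.comp (.csum A B))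
  | cinr_cong {Γ Δ t t' A B} : EEq Γ Δ t t' (.comp B) →
      EEq Γ Δ (.cinr t) (.cinr t') (.comp (.csum A B))
  | ccase_cong {Γ Δ s s' t t' u u' A B C} : EEq Γ Δ s s' (.comp (.csum A B)) →
      EEq Γ (some A) t t' (.comp C) → EEq Γ (some B) u u' (.comp C) →
      EEq Γ Δ (.ccase s t u) (.ccase s' t' u') (.comp C)
  | llam_cong {Γ t t' A B} : EEq Γ (some A) t t' (.comp B) →
      EEq Γ none (.llam A t) (.llam A t') (.lin A B)
  | lapp_cong {Γ Δ s s' t t' A B} : EEq Γ none s s' (.lin A B) → EEq Γ Δ t t' (.comp A) →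
      EEq Γ Δ (.lapp s t) (.lapp s' t') (.comp B)
  -- the equalities of Figure 2
  | unit_eta {Γ t} : Deriv Γ none t .unit → EEq Γ none t .unit .unit
  | vfst_beta {Γ t u A B} : Deriv Γ none t A → Deriv Γ none u B →
      EEq Γ none (.vfst (.vpair t u)) t A
  | vsnd_beta {Γ t u A B} : Deriv Γ none t A → Deriv Γ none u B →
      EEq Γ none (.vsnd (.vpair t u)) u B
  | vpair_eta {Γ t A B} : Deriv Γ none t (.prod A B) →
      EEq Γ none (.vpair (.vfst t) (.vsnd t)) t (.prod A B)
  | vlam_beta {Γ t u A B} : Deriv (A :: Γ) none t B → Deriv Γ none u A →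
      EEq Γ none (.vapp (.vlam A t) u) (Tm.subst0 u t) B
  | vlam_eta {Γ t A B} : Deriv Γ none t (.arr A B) →
      EEq Γ none (.vlam A (.vapp (Tm.shift t) (.var 0))) t (.arr A B)
  | cunit_eta {Γ Δ t} : Deriv Γ Δ t (.comp .cunit) → EEq Γ Δ t .cunit (.comp .cunit)
  | cfst_beta {Γ Δ t u A B} : Deriv Γ Δ t (.comp A) → Deriv Γ Δ u (.comp B) →
      EEq Γ Δ (.cfst (.cpair t u)) t (.comp A)
  | csnd_beta {Γ Δ t u A B} : Deriv Γ Δ t (.comp A) → Deriv Γ Δ u (.comp B) →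
      EEq Γ Δ (.csnd (.cpair t u)) u (.comp B)
  | cpair_eta {Γ Δ t A B} : Deriv Γ Δ t (.comp (.cand A B)) →
      EEq Γ Δ (.cpair (.cfst t) (.csnd t)) t (.comp (.cand A B))
  | clam_beta {Γ Δ t u A B} : Deriv (A :: Γ) Δ t (.comp B) → Deriv Γ none u A →
      EEq Γ Δ (.capp (.clam A t) u) (Tm.subst0 u t) (.comp B)
  | clam_eta {Γ Δ t A B} : Deriv Γ Δ t (.comp (.carr A B)) →
      EEq Γ Δ (.clam A (.capp (Tm.shift t) (.var 0))) t (.comp (.carr A B))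
  | ilet_beta {Γ t A} : Deriv Γ none t (.comp A) →
      EEq Γ none (.ilet .top t) t (.comp A)
  | ilet_eta {Γ Δ t u A} : Deriv Γ Δ t (.comp .iunit) → Deriv Γ (some .iunit) u (.comp A) →
      EEq Γ Δ (.ilet t (Tm.ssubst .top u)) (Tm.ssubst t u) (.comp A)
  | bang_beta {Γ t u A B} : Deriv Γ none t A → Deriv (A :: Γ) none u (.comp B) →
      EEq Γ none (.banglet (.bang t) u) (Tm.subst0 t u) (.comp B)
  | bang_eta {Γ Δ t u A B} : Deriv Γ Δ t (.comp (.bang A)) →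
      Deriv Γ (some (.bang A)) u (.comp B) →
      EEq Γ Δ (.banglet t (Tm.ssubst (.bang (.var 0)) (Tm.shift u))) (Tm.ssubst t u) (.comp B)
  | copow_beta {Γ Δ t s u A B C} : Deriv Γ none t A → Deriv Γ Δ s (.comp B) →
      Deriv (A :: Γ) (some B) u (.comp C) →
      EEq Γ Δ (.copowlet (.copow t s) u) (Tm.ssubst s (Tm.subst0 t u)) (.comp C)
  | copow_eta {Γ Δ t u A B C} : Deriv Γ Δ t (.comp (.copow A B)) →
      Deriv Γ (some (.copow A B)) u (.comp C) →
      EEq Γ Δ (.copowlet t (Tm.ssubst (.copow (.var 0) .svar) (Tm.shift u))) (Tm.ssubst t u) (.comp C)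
  | czero_eta {Γ Δ t u A} : Deriv Γ Δ t (.comp .czero) → Deriv Γ (some .czero) u (.comp A) →
      EEq Γ Δ (.cimage A t) (Tm.ssubst t u) (.comp A)
  | csum_beta_inl {Γ Δ t u u' A B C} : Deriv Γ (some A) u (.comp C) →
      Deriv Γ (some B) u' (.comp C) → Deriv Γ Δ t (.comp A) →
      EEq Γ Δ (.ccase (.cinl t) u u') (Tm.ssubst t u) (.comp C)
  | csum_beta_inr {Γ Δ t u u' A B C} : Deriv Γ (some A) u (.comp C) →
      Deriv Γ (some B) u' (.comp C) → Deriv Γ Δ t (.comp B) →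
      EEq Γ Δ (.ccase (.cinr t) u u') (Tm.ssubst t u') (.comp C)
  | csum_eta {Γ Δ t u A B C} : Deriv Γ Δ t (.comp (.csum A B)) →
      Deriv Γ (some (.csum A B)) u (.comp C) →
      EEq Γ Δ (.ccase t (Tm.ssubst (.cinl .svar) u) (Tm.ssubst (.cinr .svar) u)) (Tm.ssubst t u) (.comp C)
  | llam_beta {Γ Δ t u A B} : Deriv Γ (some A) t (.comp B) → Deriv Γ Δ u (.comp A) →
      EEq Γ Δ (.lapp (.llam A t) u) (Tm.ssubst u t) (.comp B)
  | llam_eta {Γ t A B} : Deriv Γ none t (.lin A B) →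
      EEq Γ none (.llam A (.lapp t .svar)) t (.lin A B)

end EEC

namespace EEC

/-! ## The generic linear-use CPS self-translation of EEC (Figures 4–6) -/

mutual
  /-- CPS translation `Aᶜ` of value types, relative to the result type `R̲`. -/
  def cpsV (R : CType) : VType → VType
    | .base a => .base a
    | .unit => .unit
    | .prod A B => .prod (cpsV R A) (cpsV R B)
    | .arr A B => .arr (cpsV R A) (cpsV R B)
    | .comp A => .lin (cpsC R A) R
    | .lin A B => .lin (cpsC R B) (cpsC R A)
  /-- CPS translation `A̲ᶜ` of computation types, relative to the result type
  `R̲` (a computation-type constant equal to `R̲` is translated to `I̲`). -/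
  def cpsC (R : CType) : CType → CType
    | .base a =>
        match R with
        | .base b => if b = a then .iunit else .base a
        | _ => .base a
    | .cunit => .czero
    | .cand A B => .csum (cpsC R A) (cpsC R B)
    | .carr A B => .copow (cpsV R A) (cpsC R B)
    | .iunit => R
    | .bang A => .carr (cpsV R A) R
    | .copow A B => .carr (cpsV R A) (cpsC R B)
    | .czero => .cunit
    | .csum A B => .cand (cpsC R A) (cpsC R B)
end

/-- Pointwise CPS translation `Γᶜ` of a context. -/
def cpsCtx (R : CType) (Γ : List VType) : List VType := Γ.map (cpsV R)

/-- The generic linear-use CPS self-translation on terms (Figures 5 and 6 of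
the paper), defined by recursion on typing derivations.  A value judgement
`Γ ⊢ t : A` is sent to a term `tᶜ` with `Γᶜ ⊢ tᶜ : Aᶜ`, and a stoup
judgement `Γ | z:A̲ ⊢ t : B̲` is sent (contravariantly) to a term `tᶜ` with
`Γᶜ | k_z:B̲ᶜ ⊢ tᶜ : A̲ᶜ`. -/
def cps (R : CType) : {Γ : List VType} → {Δ : Option CType} → {t : Tm} → {A : VType} →
    Deriv Γ Δ t A → Tm
  | _, _, _, _, .var _ n _ _ => .var n
  | _, _, _, _, .svar _ _ => .svar
  | _, _, _, _, .unit _ => .unit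
  | _, _, _, _, .vpair _ _ _ _ _ d1 d2 => .vpair (cps R d1) (cps R d2)
  | _, _, _, _, .vfst _ _ _ _ d => .vfst (cps R d)
  | _, _, _, _, .vsnd _ _ _ _ d => .vsnd (cps R d)
  | _, _, _, _, .vlam _ _ A _ d => .vlam (cpsV R A) (cps R d)
  | _, _, _, _, .vapp _ _ _ _ _ d1 d2 => .vapp (cps R d1) (cps R d2)
  | _, _, _, _, .cunit _ none => .llam .czero (.cimage R .svar)
  | _, _, _, _, .cunit _ (some D) => .cimage (cpsC R D) .svar
  | _, _, _, _, .cpair _ none _ _ A B d1 d2 =>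
      .llam (.csum (cpsC R A) (cpsC R B))
        (.ccase .svar (.lapp (cps R d1) .svar) (.lapp (cps R d2) .svar))
  | _, _, _, _, .cpair _ (some _) _ _ _ _ d1 d2 => .ccase .svar (cps R d1) (cps R d2)
  | _, _, _, _, .cfst _ none _ A _ d => .llam (cpsC R A) (.lapp (cps R d) (.cinl .svar))
  | _, _, _, _, .cfst _ (some _) _ _ _ d => Tm.ssubst (.cinl .svar) (cps R d)
  | _, _, _, _, .csnd _ none _ _ B d => .llam (cpsC R B) (.lapp (cps R d) (.cinr .svar))
  | _, _, _, _, .csnd _ (some _) _ _ _ d => Tm.ssubst (.cinr .svar) (cps R d)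
  | _, _, _, _, .clam _ none _ A B d =>
      .llam (.copow (cpsV R A) (cpsC R B)) (.copowlet .svar (.lapp (cps R d) .svar))
  | _, _, _, _, .clam _ (some _) _ _ _ d => .copowlet .svar (cps R d)
  | _, _, _, _, .capp _ none _ _ _ B d1 d2 =>
      .llam (cpsC R B) (.lapp (cps R d1) (.copow (cps R d2) .svar))
  | _, _, _, _, .capp _ (some _) _ _ _ _ d1 d2 =>
      Tm.ssubst (.copow (cps R d2) .svar) (cps R d1)
  | _, _, _, _, .top _ => .llam R .svar
  | _, _, _, _, .ilet _ none _ _ A d1 d2 =>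
      .llam (cpsC R A) (.lapp (cps R d1) (.lapp (cps R d2) .svar))
  | _, _, _, _, .ilet _ (some _) _ _ _ d1 d2 =>
      Tm.ssubst (.lapp (cps R d2) .svar) (cps R d1)
  | _, _, _, _, .bang _ _ A d => .llam (.carr (cpsV R A) R) (.capp .svar (cps R d))
  | _, _, _, _, .banglet _ none _ _ A B d1 d2 =>
      .llam (cpsC R B) (.lapp (cps R d1) (.clam (cpsV R A) (.lapp (cps R d2) .svar)))
  | _, _, _, _, .banglet _ (some _) _ _ A _ d1 d2 =>
      Tm.ssubst (.clam (cpsV R A) (.lapp (cps R d2) .svar)) (cps R d1)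
  | _, _, _, _, .copow _ none _ _ A B d1 d2 =>
      .llam (.carr (cpsV R A) (cpsC R B)) (.lapp (cps R d2) (.capp .svar (cps R d1)))
  | _, _, _, _, .copow _ (some _) _ _ _ _ d1 d2 =>
      Tm.ssubst (.capp .svar (cps R d1)) (cps R d2)
  | _, _, _, _, .copowlet _ none _ _ A _ C d1 d2 =>
      .llam (cpsC R C) (.lapp (cps R d1) (.clam (cpsV R A) (cps R d2)))
  | _, _, _, _, .copowlet _ (some _) _ _ A _ _ d1 d2 =>
      Tm.ssubst (.clam (cpsV R A) (cps R d2)) (cps R d1)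
  | _, _, _, _, .cimage _ none _ A d => .llam (cpsC R A) (.lapp (cps R d) .cunit)
  | _, _, _, _, .cimage _ (some _) _ _ d => Tm.ssubst .cunit (cps R d)
  | _, _, _, _, .cinl _ none _ A B d =>
      .llam (.cand (cpsC R A) (cpsC R B)) (.lapp (cps R d) (.cfst .svar))
  | _, _, _, _, .cinl _ (some _) _ _ _ d => Tm.ssubst (.cfst .svar) (cps R d)
  | _, _, _, _, .cinr _ none _ A B d =>
      .llam (.cand (cpsC R A) (cpsC R B)) (.lapp (cps R d) (.csnd .svar))
  | _, _, _, _, .cinr _ (some _) _ _ _ d => Tm.ssubst (.csnd .svar) (cps R d)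
  | _, _, _, _, .ccase _ none _ _ _ _ _ C d1 d2 d3 =>
      .llam (cpsC R C) (.lapp (cps R d1) (.cpair (cps R d2) (cps R d3)))
  | _, _, _, _, .ccase _ (some _) _ _ _ _ _ _ d1 d2 d3 =>
      Tm.ssubst (.cpair (cps R d2) (cps R d3)) (cps R d1)
  | _, _, _, _, .llam _ _ _ B d => .llam (cpsC R B) (cps R d)
  | _, _, _, _, .lapp _ none _ _ _ B d1 d2 =>
      .llam (cpsC R B) (.lapp (cps R d2) (.lapp (cps R d1) .svar))
  | _, _, _, _, .lapp _ (some _) _ _ _ _ d1 d2 =>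
      Tm.ssubst (.lapp (cps R d1) .svar) (cps R d2)

end EEC

namespace EEC

/-! ## The type isomorphisms `ι` of Figure 7, with explicit inverses -/

mutual
  /-- The closed term `ι_A : (Aᶜ)ᶜ → A` (Figure 7). -/
  def iotaV (R : CType) : VType → Tm
    | .base a => .vlam (.base a) (.var 0)
    | .unit => .vlam .unit .unit
    | .prod A B => .vlam (cpsV R (cpsV R (.prod A B)))
        (.vpair (.vapp (iotaV R A) (.vfst (.var 0))) (.vapp (iotaV R B) (.vsnd (.var 0))))
    | .arr A B => .vlam (cpsV R (cpsV R (.arr A B)))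
        (.vlam A (.vapp (iotaV R B) (.vapp (.var 1) (.vapp (iotaVinv R A) (.var 0)))))
    | .comp A => .vlam (cpsV R (cpsV R (.comp A)))
        (.lapp (iotaC R A) (.lapp (.var 0) .top))
    | .lin A B => .vlam (cpsV R (cpsV R (.lin A B)))
        (.llam A (.lapp (iotaC R B) (.lapp (.var 0) (.lapp (iotaCinv R A) .svar))))
  /-- The closed term `ι_A⁻¹ : A → (Aᶜ)ᶜ`. -/
  def iotaVinv (R : CType) : VType → Tm
    | .base a => .vlam (.base a) (.var 0)
    | .unit => .vlam .unit .unit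
    | .prod A B => .vlam (.prod A B)
        (.vpair (.vapp (iotaVinv R A) (.vfst (.var 0))) (.vapp (iotaVinv R B) (.vsnd (.var 0))))
    | .arr A B => .vlam (.arr A B)
        (.vlam (cpsV R (cpsV R A)) (.vapp (iotaVinv R B) (.vapp (.var 1) (.vapp (iotaV R A) (.var 0)))))
    | .comp A => .vlam (.comp A)
        (.llam .iunit (.ilet .svar (.lapp (iotaCinv R A) (.var 0))))
    | .lin A B => .vlam (.lin A B)
        (.llam (cpsC R (cpsC R A)) (.lapp (iotaCinv R B) (.lapp (.var 0) (.lapp (iotaC R A) .svar))))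
  /-- The closed term `ι_A̲ : (A̲ᶜ)ᶜ ⊸ A̲` (Figure 7). -/
  def iotaC (R : CType) : CType → Tm
    | .base a => .llam (cpsC R (cpsC R (.base a))) .svar
    | .cunit => .llam (cpsC R (cpsC R .cunit)) .cunit
    | .cand A B => .llam (cpsC R (cpsC R (.cand A B)))
        (.cpair (.lapp (iotaC R A) (.cfst .svar)) (.lapp (iotaC R B) (.csnd .svar)))
    | .carr A B => .llam (cpsC R (cpsC R (.carr A B)))
        (.clam A (.lapp (iotaC R B) (.capp .svar (.vapp (iotaVinv R A) (.var 0)))))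
    | .iunit => .llam (cpsC R (cpsC R .iunit)) .svar
    | .bang A => .llam (cpsC R (cpsC R (.bang A)))
        (.copowlet .svar (.ilet .svar (.bang (.vapp (iotaV R A) (.var 0)))))
    | .copow A B => .llam (cpsC R (cpsC R (.copow A B)))
        (.copowlet .svar (.copow (.vapp (iotaV R A) (.var 0)) (.lapp (iotaC R B) .svar)))
    | .czero => .llam (cpsC R (cpsC R .czero)) .svar
    | .csum A B => .llam (cpsC R (cpsC R (.csum A B)))
        (.ccase .svar (.cinl (.lapp (iotaC R A) .svar)) (.cinr (.lapp (iotaC R B) .svar)))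
  /-- The closed term `ι_A̲⁻¹ : A̲ ⊸ (A̲ᶜ)ᶜ`. -/
  def iotaCinv (R : CType) : CType → Tm
    | .base a => .llam (.base a) .svar
    | .cunit => .llam .cunit .cunit
    | .cand A B => .llam (.cand A B)
        (.cpair (.lapp (iotaCinv R A) (.cfst .svar)) (.lapp (iotaCinv R B) (.csnd .svar)))
    | .carr A B => .llam (.carr A B)
        (.clam (cpsV R (cpsV R A)) (.lapp (iotaCinv R B) (.capp .svar (.vapp (iotaV R A) (.var 0)))))
    | .iunit => .llam .iunit .svar
    | .bang A => .llam (.bang A)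
        (.banglet .svar (.copow (.vapp (iotaVinv R A) (.var 0)) .top))
    | .copow A B => .llam (.copow A B)
        (.copowlet .svar (.copow (.vapp (iotaVinv R A) (.var 0)) (.lapp (iotaCinv R B) .svar)))
    | .czero => .llam .czero .svar
    | .csum A B => .llam (.csum A B)
        (.ccase .svar (.cinl (.lapp (iotaCinv R A) .svar)) (.cinr (.lapp (iotaCinv R B) .svar)))
end

/-- The substitution `[ι⁻¹(Γ)]`, replacing each variable `xᵢ : Cᵢ` of `Γ` by
`ι_{Cᵢ}⁻¹(xᵢ)`. -/
def iotaSubst (R : CType) (Γ : List VType) (t : Tm) : Tm :=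
  Tm.psubst (fun n =>
    match Γ[n]? with
    | some C => .vapp (iotaVinv R C) (.var n)
    | none => .var n) t

/-! ## The simply-typed λ-calculus -/

/-- Simple types. -/
inductive STy : Type
  | base : ℕ → STy
  | unit : STy
  | prod : STy → STy → STy
  | arr : STy → STy → STy

/-- Raw simply-typed λ-terms (de Bruijn indices). -/
inductive LTm : Type
  | var : ℕ → LTm
  | unit : LTm
  | pair : LTm → LTm → LTm
  | fst : LTm → LTm
  | snd : LTm → LTm
  | lam : STy → LTm → LTm
  | app : LTm → LTm → LTm

namespace LTm

/-- Renaming of variables. -/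
def rename (f : ℕ → ℕ) : LTm → LTm
  | .var n => .var (f n)
  | .unit => .unit
  | .pair M N => .pair (rename f M) (rename f N)
  | .fst M => .fst (rename f M)
  | .snd M => .snd (rename f M)
  | .lam σ M => .lam σ (rename (Tm.liftN f) M)
  | .app M N => .app (rename f M) (rename f N)

/-- Weakening. -/
def shift (M : LTm) : LTm := rename Nat.succ M

/-- Parallel capture-avoiding substitution. -/
def psubst (σ : ℕ → LTm) : LTm → LTm
  | .var n => σ n
  | .unit => .unit
  | .pair M N => .pair (psubst σ M) (psubst σ N)
  | .fst M => .fst (psubst σ M)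
  | .snd M => .snd (psubst σ M)
  | .lam τ M => .lam τ (psubst (fun n => match n with | 0 => .var 0 | m + 1 => shift (σ m)) M)
  | .app M N => .app (psubst σ M) (psubst σ N)

/-- Capture-avoiding substitution `M[N/x]` for the innermost variable. -/
def subst0 (N : LTm) (M : LTm) : LTm :=
  psubst (fun n => match n with | 0 => N | m + 1 => .var m) M

end LTm

/-- Typing derivations of the simply-typed λ-calculus (Figure 3). -/
inductive LDeriv : List STy → LTm → STy → Type
  | var (Θ : List STy) (n : ℕ) (σ : STy) : Θ[n]? = some σ → LDeriv Θ (.var n) σ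
  | unit (Θ : List STy) : LDeriv Θ .unit .unit
  | pair (Θ : List STy) (M N : LTm) (σ τ : STy) :
      LDeriv Θ M σ → LDeriv Θ N τ → LDeriv Θ (.pair M N) (.prod σ τ)
  | fst (Θ : List STy) (M : LTm) (σ τ : STy) :
      LDeriv Θ M (.prod σ τ) → LDeriv Θ (.fst M) σ
  | snd (Θ : List STy) (M : LTm) (σ τ : STy) :
      LDeriv Θ M (.prod σ τ) → LDeriv Θ (.snd M) τ
  | lam (Θ : List STy) (M : LTm) (σ τ : STy) :
      LDeriv (σ :: Θ) M τ → LDeriv Θ (.lam σ M) (.arr σ τ)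
  | app (Θ : List STy) (M N : LTm) (σ τ : STy) :
      LDeriv Θ M (.arr σ τ) → LDeriv Θ N σ → LDeriv Θ (.app M N) τ

/-- Values of the (call-by-value) λ-calculus. -/
inductive LVal : LTm → Prop
  | var (n : ℕ) : LVal (.var n)
  | unit : LVal .unit
  | lam (σ : STy) (M : LTm) : LVal (.lam σ M)
  | pair {M N : LTm} : LVal M → LVal N → LVal (.pair M N)

/-- βη-equality of the simply-typed λ-calculus. -/
inductive LBetaEta : List STy → LTm → LTm → STy → Prop
  | refl {Θ M σ} : LDeriv Θ M σ → LBetaEta Θ M M σ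
  | symm {Θ M N σ} : LBetaEta Θ M N σ → LBetaEta Θ N M σ
  | trans {Θ M N P σ} : LBetaEta Θ M N σ → LBetaEta Θ N P σ → LBetaEta Θ M P σ
  | pair_cong {Θ M M' N N' σ τ} : LBetaEta Θ M M' σ → LBetaEta Θ N N' τ →
      LBetaEta Θ (.pair M N) (.pair M' N') (.prod σ τ)
  | fst_cong {Θ M M' σ τ} : LBetaEta Θ M M' (.prod σ τ) → LBetaEta Θ (.fst M) (.fst M') σ
  | snd_cong {Θ M M' σ τ} : LBetaEta Θ M M' (.prod σ τ) → LBetaEta Θ (.snd M) (.snd M') τ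
  | lam_cong {Θ M M' σ τ} : LBetaEta (σ :: Θ) M M' τ →
      LBetaEta Θ (.lam σ M) (.lam σ M') (.arr σ τ)
  | app_cong {Θ M M' N N' σ τ} : LBetaEta Θ M M' (.arr σ τ) → LBetaEta Θ N N' σ →
      LBetaEta Θ (.app M N) (.app M' N') τ
  | beta {Θ M N σ τ} : LDeriv (σ :: Θ) M τ → LDeriv Θ N σ →
      LBetaEta Θ (.app (.lam σ M) N) (LTm.subst0 N M) τ
  | eta {Θ M σ τ} : LDeriv Θ M (.arr σ τ) →
      LBetaEta Θ (.lam σ (.app (LTm.shift M) (.var 0))) M (.arr σ τ)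
  | fst_beta {Θ M N σ τ} : LDeriv Θ M σ → LDeriv Θ N τ →
      LBetaEta Θ (.fst (.pair M N)) M σ
  | snd_beta {Θ M N σ τ} : LDeriv Θ M σ → LDeriv Θ N τ →
      LBetaEta Θ (.snd (.pair M N)) N τ
  | pair_eta {Θ M σ τ} : LDeriv Θ M (.prod σ τ) →
      LBetaEta Θ (.pair (.fst M) (.snd M)) M (.prod σ τ)
  | unit_eta {Θ M} : LDeriv Θ M .unit → LBetaEta Θ M .unit .unit

/-- Equality in Moggi's computational λ-calculus `λc` (call-by-value
βη-equalities restricted to values, together with the `let`-laws, expressed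
via the standard encoding `let x = M in N := (λx.N) M`). -/
inductive LamC : List STy → LTm → LTm → STy → Prop
  | refl {Θ M σ} : LDeriv Θ M σ → LamC Θ M M σ
  | symm {Θ M N σ} : LamC Θ M N σ → LamC Θ N M σ
  | trans {Θ M N P σ} : LamC Θ M N σ → LamC Θ N P σ → LamC Θ M P σ
  | pair_cong {Θ M M' N N' σ τ} : LamC Θ M M' σ → LamC Θ N N' τ →
      LamC Θ (.pair M N) (.pair M' N') (.prod σ τ)
  | fst_cong {Θ M M' σ τ} : LamC Θ M M' (.prod σ τ) → LamC Θ (.fst M) (.fst M') σ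
  | snd_cong {Θ M M' σ τ} : LamC Θ M M' (.prod σ τ) → LamC Θ (.snd M) (.snd M') τ
  | lam_cong {Θ M M' σ τ} : LamC (σ :: Θ) M M' τ →
      LamC Θ (.lam σ M) (.lam σ M') (.arr σ τ)
  | app_cong {Θ M M' N N' σ τ} : LamC Θ M M' (.arr σ τ) → LamC Θ N N' σ →
      LamC Θ (.app M N) (.app M' N') τ
  | beta_v {Θ M V σ τ} : LDeriv (σ :: Θ) M τ → LDeriv Θ V σ → LVal V →
      LamC Θ (.app (.lam σ M) V) (LTm.subst0 V M) τ
  | eta_v {Θ V σ τ} : LVal V → LDeriv Θ V (.arr σ τ) →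
      LamC Θ (.lam σ (.app (LTm.shift V) (.var 0))) V (.arr σ τ)
  | fst_beta_v {Θ V W σ τ} : LVal V → LVal W → LDeriv Θ V σ → LDeriv Θ W τ →
      LamC Θ (.fst (.pair V W)) V σ
  | snd_beta_v {Θ V W σ τ} : LVal V → LVal W → LDeriv Θ V σ → LDeriv Θ W τ →
      LamC Θ (.snd (.pair V W)) W τ
  | pair_eta_v {Θ V σ τ} : LVal V → LDeriv Θ V (.prod σ τ) →
      LamC Θ (.pair (.fst V) (.snd V)) V (.prod σ τ)
  | unit_eta_v {Θ V} : LVal V → LDeriv Θ V .unit → LamC Θ V .unit .unit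
  | let_eta {Θ M σ} : LDeriv Θ M σ → LamC Θ (.app (.lam σ (.var 0)) M) M σ
  | let_assoc {Θ M N L σ ρ τ} : LDeriv (σ :: Θ) M τ → LDeriv (ρ :: Θ) N σ →
      LDeriv Θ L ρ →
      LamC Θ (.app (.lam σ M) (.app (.lam ρ N) L))
        (.app (.lam ρ (.app (.lam σ (LTm.rename (Tm.liftN Nat.succ) M)) N)) L) τ
  | app_left {Θ M N σ τ} : LDeriv Θ M (.arr σ τ) → LDeriv Θ N σ →
      LamC Θ (.app M N) (.app (.lam (.arr σ τ) (.app (.var 0) (LTm.shift N))) M) τ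
  | app_right {Θ V N σ τ} : LVal V → LDeriv Θ V (.arr σ τ) → LDeriv Θ N σ →
      LamC Θ (.app V N) (.app (.lam σ (.app (LTm.shift V) (.var 0))) N) τ
  | pair_left {Θ M N σ τ} : LDeriv Θ M σ → LDeriv Θ N τ →
      LamC Θ (.pair M N) (.app (.lam σ (.pair (.var 0) (LTm.shift N))) M) (.prod σ τ)
  | pair_right {Θ V N σ τ} : LVal V → LDeriv Θ V σ → LDeriv Θ N τ →
      LamC Θ (.pair V N) (.app (.lam τ (.pair (LTm.shift V) (.var 0))) N) (.prod σ τ)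
  | fst_cc {Θ M σ τ} : LDeriv Θ M (.prod σ τ) →
      LamC Θ (.fst M) (.app (.lam (.prod σ τ) (.fst (.var 0))) M) σ
  | snd_cc {Θ M σ τ} : LDeriv Θ M (.prod σ τ) →
      LamC Θ (.snd M) (.app (.lam (.prod σ τ) (.snd (.var 0))) M) τ

end EEC

namespace EEC

/-! ## The standard cbv and cbn translations of typed λ-calculus into EEC -/

/-- The computation-type constant `α̲` associated with a simply-typed
λ-calculus type constant `α` (the association is injective but not
surjective, so that some computation-type constants of EEC are different
from `α̲` for every λ-calculus type constant `α`). -/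
def assocC (a : ℕ) : CType := .base (a + 1)

/-- The call-by-value translation `σᵛ` on types. -/
def cbvT : STy → VType
  | .base a => .base a
  | .unit => .unit
  | .prod σ τ => .prod (cbvT σ) (cbvT τ)
  | .arr σ τ => .arr (cbvT σ) (.comp (.bang (cbvT τ)))

/-- The call-by-value translation `Θᵛ` on contexts. -/
def cbvCtx (Θ : List STy) : List VType := Θ.map cbvT

/-- The call-by-value translation on terms: `Θ ⊢ M : τ` is sent to
`Θᵛ ⊢ Mᵛ : !(τᵛ)`. -/
def cbvTm : LTm → Tm
  | .var n => .bang (.var n)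
  | .unit => .bang .unit
  | .pair M N => .banglet (cbvTm M) (.banglet (Tm.shift (cbvTm N)) (.bang (.vpair (.var 1) (.var 0))))
  | .fst M => .banglet (cbvTm M) (.bang (.vfst (.var 0)))
  | .snd M => .banglet (cbvTm M) (.bang (.vsnd (.var 0)))
  | .lam σ M => .bang (.vlam (cbvT σ) (cbvTm M))
  | .app M N => .banglet (cbvTm M) (.banglet (Tm.shift (cbvTm N)) (.vapp (.var 1) (.var 0)))

/-- The call-by-name translation `σⁿ` on types. -/
def cbnT : STy → CType
  | .base a => assocC a
  | .unit => .cunit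
  | .prod σ τ => .cand (cbnT σ) (cbnT τ)
  | .arr σ τ => .carr (.comp (cbnT σ)) (cbnT τ)

/-- The call-by-name translation `Θⁿ` on contexts. -/
def cbnCtx (Θ : List STy) : List VType := Θ.map (fun σ => .comp (cbnT σ))

/-- The call-by-name translation on terms: `Θ ⊢ M : τ` is sent to
`Θⁿ ⊢ Mⁿ : τⁿ`, mimicking each construct by the corresponding
computation-type construct of EEC. -/
def cbnTm : LTm → Tm
  | .var n => .var n
  | .unit => .cunit
  | .pair M N => .cpair (cbnTm M) (cbnTm N)
  | .fst M => .cfst (cbnTm M)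
  | .snd M => .csnd (cbnTm M)
  | .lam σ M => .clam (.comp (cbnT σ)) (cbnTm M)
  | .app M N => .capp (cbnTm M) (cbnTm N)

/-! ## Hasegawa's linear-use CPS translations (Section 4) -/

/-- The call-by-value linear-use CPS translation `σᵛᶜ` on types. -/
def cbvcpsT (R : CType) : STy → VType
  | .base a => .base a
  | .unit => .unit
  | .prod σ τ => .prod (cbvcpsT R σ) (cbvcpsT R τ)
  | .arr σ τ => .arr (cbvcpsT R σ) (.lin (.carr (cbvcpsT R τ) R) R)

/-- `Θᵛᶜ`. -/
def cbvcpsCtx (R : CType) (Θ : List STy) : List VType := Θ.map (cbvcpsT R)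

/-- The call-by-value linear-use CPS translation on terms: `Θ ⊢ M : τ` is
sent to `Θᵛᶜ ⊢ Mᵛᶜ : (τᵛᶜ ⇒ R̲) ⊸ R̲`. -/
def cbvcps (R : CType) : {Θ : List STy} → {M : LTm} → {σ : STy} → LDeriv Θ M σ → Tm
  | _, _, _, .var _ n σ _ => .llam (.carr (cbvcpsT R σ) R) (.capp .svar (.var n))
  | _, _, _, .unit _ => .llam (.carr .unit R) (.capp .svar .unit)
  | _, _, _, .pair _ _ _ σ τ dM dN =>
      .llam (.carr (.prod (cbvcpsT R σ) (cbvcpsT R τ)) R)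
        (.lapp (cbvcps R dM)
          (.clam (cbvcpsT R σ)
            (.lapp (Tm.shift (cbvcps R dN))
              (.clam (cbvcpsT R τ) (.capp .svar (.vpair (.var 1) (.var 0)))))))
  | _, _, _, .fst _ _ σ τ dM =>
      .llam (.carr (cbvcpsT R σ) R)
        (.lapp (cbvcps R dM)
          (.clam (.prod (cbvcpsT R σ) (cbvcpsT R τ)) (.capp .svar (.vfst (.var 0)))))
  | _, _, _, .snd _ _ σ τ dM =>
      .llam (.carr (cbvcpsT R τ) R)
        (.lapp (cbvcps R dM)
          (.clam (.prod (cbvcpsT R σ) (cbvcpsT R τ)) (.capp .svar (.vsnd (.var 0)))))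
  | _, _, _, .lam _ _ σ τ dM =>
      .llam (.carr (.arr (cbvcpsT R σ) (.lin (.carr (cbvcpsT R τ) R) R)) R)
        (.capp .svar (.vlam (cbvcpsT R σ) (cbvcps R dM)))
  | _, _, _, .app _ _ _ σ τ dM dN =>
      .llam (.carr (cbvcpsT R τ) R)
        (.lapp (cbvcps R dM)
          (.clam (.arr (cbvcpsT R σ) (.lin (.carr (cbvcpsT R τ) R) R))
            (.lapp (Tm.shift (cbvcps R dN))
              (.clam (cbvcpsT R σ) (.lapp (.vapp (.var 1) (.var 0)) .svar)))))

/-- The call-by-name linear-use CPS translation `σⁿᶜ` on types. -/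
def cbncpsT (R : CType) : STy → CType
  | .base a => assocC a
  | .unit => .czero
  | .prod σ τ => .csum (cbncpsT R σ) (cbncpsT R τ)
  | .arr σ τ => .copow (.lin (cbncpsT R σ) R) (cbncpsT R τ)

/-- `Θⁿᶜ ⊸ R̲`, assigning each variable `xᵢ : σᵢ` the type `σᵢⁿᶜ ⊸ R̲`. -/
def cbncpsCtx (R : CType) (Θ : List STy) : List VType :=
  Θ.map (fun σ => .lin (cbncpsT R σ) R)

/-- The call-by-name linear-use CPS translation on terms: `Θ ⊢ M : τ` is
sent to `Θⁿᶜ ⊸ R̲ ⊢ Mⁿᶜ : τⁿᶜ ⊸ R̲`. -/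
def cbncps (R : CType) : {Θ : List STy} → {M : LTm} → {σ : STy} → LDeriv Θ M σ → Tm
  | _, _, _, .var _ n _ _ => .var n
  | _, _, _, .unit _ => .llam .czero (.cimage R .svar)
  | _, _, _, .pair _ _ _ σ τ dM dN =>
      .llam (.csum (cbncpsT R σ) (cbncpsT R τ))
        (.ccase .svar (.lapp (cbncps R dM) .svar) (.lapp (cbncps R dN) .svar))
  | _, _, _, .fst _ _ σ _τ dM => .llam (cbncpsT R σ) (.lapp (cbncps R dM) (.cinl .svar))
  | _, _, _, .snd _ _ _ τ dM => .llam (cbncpsT R τ) (.lapp (cbncps R dM) (.cinr .svar))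
  | _, _, _, .lam _ _ σ τ dM =>
      .llam (.copow (.lin (cbncpsT R σ) R) (cbncpsT R τ))
        (.copowlet .svar (.lapp (cbncps R dM) .svar))
  | _, _, _, .app _ _ _ σ τ dM dN =>
      .llam (cbncpsT R τ) (.lapp (cbncps R dM) (.copow (cbncps R dN) .svar))

end EEC

namespace EEC

/-! ## Substitution in EEC terms -/

namespace Tm

/-- The parallel substitution sending the innermost variable to `a` and the others along `γ`. -/
def cons (a : Tm) (γ : ℕ → Tm) : ℕ → Tm
  | 0 => a
  | n + 1 => γ n

/-- Simultaneous substitution of `γ` for the value variables and of `b` for the stoup variable. -/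
def msub (γ : ℕ → Tm) (b : Tm) : Tm → Tm
  | .var n => γ n
  | .svar => b
  | .unit => .unit
  | .vpair t u => .vpair (msub γ b t) (msub γ b u)
  | .vfst t => .vfst (msub γ b t)
  | .vsnd t => .vsnd (msub γ b t)
  | .vlam A t => .vlam A (msub (liftS γ) (shift b) t)
  | .vapp s t => .vapp (msub γ b s) (msub γ b t)
  | .cunit => .cunit
  | .cpair t u => .cpair (msub γ b t) (msub γ b u)
  | .cfst t => .cfst (msub γ b t)
  | .csnd t => .csnd (msub γ b t)
  | .clam A t => .clam A (msub (liftS γ) (shift b) t)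
  | .capp s t => .capp (msub γ b s) (msub γ b t)
  | .top => .top
  | .ilet t u => .ilet (msub γ b t) (msub γ b u)
  | .bang t => .bang (msub γ b t)
  | .banglet t u => .banglet (msub γ b t) (msub (liftS γ) (shift b) u)
  | .copow t u => .copow (msub γ b t) (msub γ b u)
  | .copowlet s t => .copowlet (msub γ b s) (msub (liftS γ) .svar t)
  | .cimage A t => .cimage A (msub γ b t)
  | .cinl t => .cinl (msub γ b t)
  | .cinr t => .cinr (msub γ b t)
  | .ccase s t u => .ccase (msub γ b s) (msub γ .svar t) (msub γ .svar u)
  | .llam A t => .llam A (msub γ .svar t)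
  | .lapp s t => .lapp (msub γ b s) (msub γ b t)

/-- The stoup variable does not occur free in `t`. -/
def StoupFree (t : Tm) : Prop := ∀ γ b, msub γ b t = msub γ .svar t

@[simp] theorem shift_svar : shift .svar = .svar := rfl

@[simp] theorem liftS_var : liftS .var = .var := by
  funext n; cases n <;> rfl

theorem liftS_comp_liftN (γ : ℕ → Tm) (f : ℕ → ℕ) : liftS γ ∘ liftN f = liftS (γ ∘ f) := by
  funext n; cases n <;> rfl

theorem liftS_var_comp (f : ℕ → ℕ) : liftS (.var ∘ f) = .var ∘ liftN f := by
  funext n; cases n <;> rfl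

theorem psubst_eq_msub (γ : ℕ → Tm) (t : Tm) : psubst γ t = msub γ .svar t := by
  induction t generalizing γ <;> simp_all [psubst, msub]

@[simp] theorem msub_var_svar (t : Tm) : msub .var .svar t = t := by
  induction t <;> simp_all [msub]

theorem ssubst_eq_msub (b t : Tm) : ssubst b t = msub .var b t := by
  induction t generalizing b <;> simp_all [ssubst, msub]

theorem subst0_eq_msub (a t : Tm) : subst0 a t = msub (cons a .var) .svar t := by
  rw [subst0, psubst_eq_msub]
  congr 1

theorem rename_eq_msub (f : ℕ → ℕ) (t : Tm) : rename f t = msub (.var ∘ f) .svar t := by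
  induction t generalizing f <;> simp_all [rename, msub, liftS_var_comp]

@[simp] theorem rename_id (t : Tm) : rename id t = t := by
  simp [rename_eq_msub]

theorem msub_rename (γ : ℕ → Tm) (b : Tm) (f : ℕ → ℕ) (t : Tm) :
    msub γ b (rename f t) = msub (γ ∘ f) b t := by
  induction t generalizing γ b f <;> simp_all [rename, msub, liftS_comp_liftN]

theorem rename_rename (f g : ℕ → ℕ) (t : Tm) : rename f (rename g t) = rename (f ∘ g) t := by
  rw [rename_eq_msub, msub_rename, rename_eq_msub]
  rfl

theorem rename_liftN_shift (f : ℕ → ℕ) (t : Tm) :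
    rename (liftN f) (shift t) = shift (rename f t) := by
  simp only [shift, rename_rename]
  rfl

theorem rename_comp_liftS (γ : ℕ → Tm) (f : ℕ → ℕ) :
    rename (liftN f) ∘ liftS γ = liftS (rename f ∘ γ) := by
  funext n
  cases n
  · rfl
  · exact rename_liftN_shift f _

theorem rename_msub (f : ℕ → ℕ) (γ : ℕ → Tm) (b t : Tm) :
    rename f (msub γ b t) = msub (rename f ∘ γ) (rename f b) t := by
  induction t generalizing γ b f <;>
    simp_all [rename, msub, rename_comp_liftS, rename_liftN_shift]

theorem msub_liftS_shift (γ : ℕ → Tm) (b t : Tm) :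
    msub (liftS γ) (shift b) (shift t) = shift (msub γ b t) := by
  rw [shift, shift, msub_rename, shift, rename_msub]
  rfl

theorem StoupFree.rename {t : Tm} (h : StoupFree t) (f : ℕ → ℕ) : StoupFree (t.rename f) :=
  fun γ b => by rw [msub_rename, msub_rename, h]

theorem StoupFree.var (n : ℕ) : StoupFree (.var n) := fun _ _ => rfl

theorem StoupFree.liftS {γ : ℕ → Tm} (h : ∀ n, StoupFree (γ n)) (n : ℕ) :
    StoupFree (liftS γ n) := by
  cases n
  · exact .var 0
  · exact (h _).rename _

theorem StoupFree.cons {a : Tm} {γ : ℕ → Tm} (ha : StoupFree a) (h : ∀ n, StoupFree (γ n))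
    (n : ℕ) : StoupFree (cons a γ n) := by
  cases n
  · exact ha
  · exact h _

theorem msub_msub {γ : ℕ → Tm} (hγ : ∀ n, StoupFree (γ n)) (δ : ℕ → Tm) (b c t : Tm) :
    msub δ c (msub γ b t) = msub (fun n => msub δ .svar (γ n)) (msub δ c b) t := by
  have hl : ∀ γ δ : ℕ → Tm, (fun n => msub (liftS δ) .svar (liftS γ n)) =
      liftS fun n => msub δ .svar (γ n) := by
    intro γ δ
    funext n
    cases n
    · rfl
    · exact msub_liftS_shift δ .svar _
  induction t generalizing γ δ b c with
  | var n => exact hγ n δ c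
  | svar => rfl
  | _ => simp_all [msub, StoupFree.liftS, msub_liftS_shift]

theorem StoupFree.msub {t : Tm} (h : StoupFree t) {γ : ℕ → Tm} (hγ : ∀ n, StoupFree (γ n))
    (b : Tm) : StoupFree (Tm.msub γ b t) := fun δ c => by
  rw [h, msub_msub hγ, msub_msub hγ, h]
  rfl

theorem subst0_msub {γ : ℕ → Tm} (hγ : ∀ n, StoupFree (γ n)) (a b t : Tm) :
    subst0 a (msub (liftS γ) (shift b) t) = msub (cons a γ) b t := by
  rw [subst0_eq_msub, msub_msub (StoupFree.liftS hγ), shift, msub_rename]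
  congr 1
  · funext n
    cases n
    · rfl
    · simp only [liftS, shift, msub_rename]
      exact msub_var_svar _
  · exact msub_var_svar _

theorem subst0_msub_svar {γ : ℕ → Tm} (hγ : ∀ n, StoupFree (γ n)) (a t : Tm) :
    subst0 a (msub (liftS γ) .svar t) = msub (cons a γ) .svar t :=
  subst0_msub hγ a .svar t

theorem ssubst_msub {γ : ℕ → Tm} (hγ : ∀ n, StoupFree (γ n)) (b c t : Tm) :
    ssubst c (msub γ b t) = msub γ (ssubst c b) t := by
  simp only [ssubst_eq_msub, msub_msub hγ, msub_var_svar]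

theorem msub_ssubst (γ : ℕ → Tm) (b c t : Tm) :
    msub γ b (ssubst c t) = msub γ (msub γ b c) t := by
  rw [ssubst_eq_msub, msub_msub StoupFree.var]
  rfl

theorem msub_subst0 (γ : ℕ → Tm) (b : Tm) {u : Tm} (hu : StoupFree u) (t : Tm) :
    msub γ b (subst0 u t) = msub (cons (msub γ b u) γ) b t := by
  rw [subst0_eq_msub, msub_msub (StoupFree.cons hu StoupFree.var), hu γ b]
  congr 1
  funext n
  cases n <;> rfl

theorem msub_cons_shift (a : Tm) (γ : ℕ → Tm) (b t : Tm) :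
    msub (cons a γ) b (shift t) = msub γ b t := by
  rw [shift, msub_rename]
  rfl

theorem rename_subst0 (f : ℕ → ℕ) (a t : Tm) :
    rename f (subst0 a t) = subst0 (rename f a) (rename (liftN f) t) := by
  simp only [subst0_eq_msub, rename_msub, msub_rename]
  congr 1
  funext n
  cases n <;> rfl

theorem rename_ssubst (f : ℕ → ℕ) (c t : Tm) :
    rename f (ssubst c t) = ssubst (rename f c) (rename f t) := by
  simp only [ssubst_eq_msub, rename_msub, msub_rename]
  rfl

end Tm

open Tm

/-! ## Typing of renamings and substitutions -/

/-- `f` is a type-preserving renaming from `Γ` to `Γ'`. -/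
def Renaming {T : Type} (f : ℕ → ℕ) (Γ Γ' : List T) : Prop :=
  ∀ n A, Γ[n]? = some A → Γ'[f n]? = some A

namespace Renaming

variable {T : Type} {f g : ℕ → ℕ} {Γ Γ' Γ'' : List T}

theorem id (Γ : List T) : Renaming id Γ Γ := fun _ _ h => h

theorem comp (hg : Renaming g Γ' Γ'') (hf : Renaming f Γ Γ') : Renaming (g ∘ f) Γ Γ'' :=
  fun n A h => hg _ A (hf n A h)

theorem succ (Γ : List T) (A : T) : Renaming Nat.succ Γ (A :: Γ) := fun _ _ h => by simpa using h

theorem liftN (hf : Renaming f Γ Γ') (A : T) : Renaming (liftN f) (A :: Γ) (A :: Γ') := by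
  rintro (_ | n) B h
  · exact h
  · simpa [Tm.liftN] using hf n B (by simpa using h)

end Renaming

theorem Deriv.rename {Γ Δ t A} (d : Deriv Γ Δ t A) {f : ℕ → ℕ} {Γ' : List VType}
    (hf : Renaming f Γ Γ') : Nonempty (Deriv Γ' Δ (t.rename f) A) := by
  induction d generalizing f Γ' with
  | var _ n A h => exact ⟨.var _ _ _ (hf n A h)⟩
  | svar => exact ⟨.svar _ _⟩
  | unit => exact ⟨.unit _⟩
  | vpair _ _ _ _ _ _ _ h1 h2 => exact ⟨.vpair _ _ _ _ _ (h1 hf).some (h2 hf).some⟩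
  | vfst _ _ _ _ _ h => exact ⟨.vfst _ _ _ _ (h hf).some⟩
  | vsnd _ _ _ _ _ h => exact ⟨.vsnd _ _ _ _ (h hf).some⟩
  | vlam _ _ _ _ _ h => exact ⟨.vlam _ _ _ _ (h (hf.liftN _)).some⟩
  | vapp _ _ _ _ _ _ _ h1 h2 => exact ⟨.vapp _ _ _ _ _ (h1 hf).some (h2 hf).some⟩
  | cunit => exact ⟨.cunit _ _⟩
  | cpair _ _ _ _ _ _ _ _ h1 h2 => exact ⟨.cpair _ _ _ _ _ _ (h1 hf).some (h2 hf).some⟩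
  | cfst _ _ _ _ _ _ h => exact ⟨.cfst _ _ _ _ _ (h hf).some⟩
  | csnd _ _ _ _ _ _ h => exact ⟨.csnd _ _ _ _ _ (h hf).some⟩
  | clam _ _ _ _ _ _ h => exact ⟨.clam _ _ _ _ _ (h (hf.liftN _)).some⟩
  | capp _ _ _ _ _ _ _ _ h1 h2 => exact ⟨.capp _ _ _ _ _ _ (h1 hf).some (h2 hf).some⟩
  | top => exact ⟨.top _⟩
  | ilet _ _ _ _ _ _ _ h1 h2 => exact ⟨.ilet _ _ _ _ _ (h1 hf).some (h2 hf).some⟩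
  | bang _ _ _ _ h => exact ⟨.bang _ _ _ (h hf).some⟩
  | banglet _ _ _ _ _ _ _ _ h1 h2 =>
    exact ⟨.banglet _ _ _ _ _ _ (h1 hf).some (h2 (hf.liftN _)).some⟩
  | copow _ _ _ _ _ _ _ _ h1 h2 => exact ⟨.copow _ _ _ _ _ _ (h1 hf).some (h2 hf).some⟩
  | copowlet _ _ _ _ _ _ _ _ _ h1 h2 =>
    exact ⟨.copowlet _ _ _ _ _ _ _ (h1 hf).some (h2 (hf.liftN _)).some⟩
  | cimage _ _ _ _ _ h => exact ⟨.cimage _ _ _ _ (h hf).some⟩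
  | cinl _ _ _ _ _ _ h => exact ⟨.cinl _ _ _ _ _ (h hf).some⟩
  | cinr _ _ _ _ _ _ h => exact ⟨.cinr _ _ _ _ _ (h hf).some⟩
  | ccase _ _ _ _ _ _ _ _ _ _ _ h1 h2 h3 =>
    exact ⟨.ccase _ _ _ _ _ _ _ _ (h1 hf).some (h2 hf).some (h3 hf).some⟩
  | llam _ _ _ _ _ h => exact ⟨.llam _ _ _ _ (h hf).some⟩
  | lapp _ _ _ _ _ _ _ _ h1 h2 => exact ⟨.lapp _ _ _ _ _ _ (h1 hf).some (h2 hf).some⟩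

theorem Deriv.stoupFree {Γ t A} (d : Deriv Γ none t A) : StoupFree t := by
  suffices ∀ Δ, Deriv Γ Δ t A → Δ = none → StoupFree t from this _ d rfl
  clear d
  intro Δ d
  unfold StoupFree
  induction d <;> simp_all [msub]

/-- `γ` is a well-typed substitution from `Γ` to `Γ'`. -/
def SubstTy (γ : ℕ → Tm) (Γ Γ' : List VType) : Prop :=
  ∀ n A, Γ[n]? = some A → Nonempty (Deriv Γ' none (γ n) A)

/-- `b` is a well-typed substituend for the stoup `Δ` in context `Γ'` with stoup `Δ'`. -/
def StoupTy (b : Tm) (Δ : Option CType) (Γ' : List VType) (Δ' : Option CType) : Prop :=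
  match Δ with
  | none => Δ' = none
  | some A => Nonempty (Deriv Γ' Δ' b (.comp A))

theorem SubstTy.var (Γ : List VType) : SubstTy .var Γ Γ := fun n A h => ⟨.var _ n A h⟩

theorem SubstTy.liftS {γ Γ Γ'} (h : SubstTy γ Γ Γ') (A : VType) :
    SubstTy (liftS γ) (A :: Γ) (A :: Γ') := by
  rintro (_ | n) B hB
  · exact ⟨.var _ _ _ hB⟩
  · exact (h n B (by simpa using hB)).some.rename (.succ Γ' A)

theorem SubstTy.cons {a γ Γ Γ' A} (ha : Nonempty (Deriv Γ' none a A)) (h : SubstTy γ Γ Γ') :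
    SubstTy (cons a γ) (A :: Γ) Γ' := by
  rintro (_ | n) B hB
  · obtain rfl : A = B := by simpa using hB
    exact ha
  · exact h n B (by simpa using hB)

theorem StoupTy.shift {b Δ Γ' Δ'} (h : StoupTy b Δ Γ' Δ') (A : VType) :
    StoupTy (shift b) Δ (A :: Γ') Δ' := by
  cases Δ
  · exact h
  · exact h.some.rename (.succ Γ' A)

theorem StoupTy.svar (Γ : List VType) (Δ : Option CType) : StoupTy .svar Δ Γ Δ := by
  cases Δ
  · rfl
  · exact ⟨.svar _ _⟩

theorem Deriv.msub {Γ Δ t A} (d : Deriv Γ Δ t A) {γ : ℕ → Tm} {b : Tm} {Γ' : List VType}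
    {Δ' : Option CType} (hγ : SubstTy γ Γ Γ') (hb : StoupTy b Δ Γ' Δ') :
    Nonempty (Deriv Γ' Δ' (Tm.msub γ b t) A) := by
  have hn : ∀ {Γ' b}, StoupTy b none Γ' none := rfl
  induction d generalizing γ b Γ' Δ' with
  | var _ n A h => cases hb; exact hγ n A h
  | svar => exact hb
  | unit => cases hb; exact ⟨.unit _⟩
  | vpair _ _ _ _ _ _ _ h1 h2 =>
    cases hb; exact ⟨.vpair _ _ _ _ _ (h1 hγ hn).some (h2 hγ hn).some⟩
  | vfst _ _ _ _ _ h => cases hb; exact ⟨.vfst _ _ _ _ (h hγ hn).some⟩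
  | vsnd _ _ _ _ _ h => cases hb; exact ⟨.vsnd _ _ _ _ (h hγ hn).some⟩
  | vlam _ _ _ _ _ h => cases hb; exact ⟨.vlam _ _ _ _ (h (hγ.liftS _) hn).some⟩
  | vapp _ _ _ _ _ _ _ h1 h2 =>
    cases hb; exact ⟨.vapp _ _ _ _ _ (h1 hγ hn).some (h2 hγ hn).some⟩
  | cunit => exact ⟨.cunit _ _⟩
  | cpair _ _ _ _ _ _ _ _ h1 h2 => exact ⟨.cpair _ _ _ _ _ _ (h1 hγ hb).some (h2 hγ hb).some⟩
  | cfst _ _ _ _ _ _ h => exact ⟨.cfst _ _ _ _ _ (h hγ hb).some⟩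
  | csnd _ _ _ _ _ _ h => exact ⟨.csnd _ _ _ _ _ (h hγ hb).some⟩
  | clam _ _ _ _ _ _ h => exact ⟨.clam _ _ _ _ _ (h (hγ.liftS _) (hb.shift _)).some⟩
  | capp _ _ _ _ _ _ _ d2 h1 h2 =>
    refine ⟨.capp _ _ _ _ _ _ (h1 hγ hb).some ?_⟩
    rw [d2.stoupFree]
    exact (h2 hγ hn).some
  | top => cases hb; exact ⟨.top _⟩
  | ilet _ _ _ _ _ _ d2 h1 h2 =>
    refine ⟨.ilet _ _ _ _ _ (h1 hγ hb).some ?_⟩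
    exact (h2 hγ hn).some
  | bang _ _ _ _ h => cases hb; exact ⟨.bang _ _ _ (h hγ hn).some⟩
  | banglet _ _ _ _ _ _ _ _ h1 h2 =>
    exact ⟨.banglet _ _ _ _ _ _ (h1 hγ hb).some (h2 (hγ.liftS _) hn).some⟩
  | copow _ _ _ _ _ _ _ _ h1 h2 =>
    exact ⟨.copow _ _ _ _ _ _ (h1 hγ hn).some (h2 hγ hb).some⟩
  | copowlet _ _ _ _ _ _ _ _ _ h1 h2 =>
    exact ⟨.copowlet _ _ _ _ _ _ _ (h1 hγ hb).some (h2 (hγ.liftS _) (.svar _ _)).some⟩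
  | cimage _ _ _ _ _ h => exact ⟨.cimage _ _ _ _ (h hγ hb).some⟩
  | cinl _ _ _ _ _ _ h => exact ⟨.cinl _ _ _ _ _ (h hγ hb).some⟩
  | cinr _ _ _ _ _ _ h => exact ⟨.cinr _ _ _ _ _ (h hγ hb).some⟩
  | ccase _ _ _ _ _ _ _ _ _ _ _ h1 h2 h3 =>
    exact ⟨.ccase _ _ _ _ _ _ _ _ (h1 hγ hb).some (h2 hγ (.svar _ _)).some
      (h3 hγ (.svar _ _)).some⟩
  | llam _ _ _ _ _ h => cases hb; exact ⟨.llam _ _ _ _ (h hγ (.svar _ _)).some⟩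
  | lapp _ _ _ _ _ _ _ _ h1 h2 => exact ⟨.lapp _ _ _ _ _ _ (h1 hγ hn).some (h2 hγ hb).some⟩

theorem Deriv.subst0 {Γ Δ t u A B} (d : Deriv (A :: Γ) Δ t B) (e : Deriv Γ none u A) :
    Nonempty (Deriv Γ Δ (subst0 u t) B) := by
  rw [subst0_eq_msub]
  exact d.msub (.cons ⟨e⟩ (.var Γ)) (.svar Γ Δ)

theorem Deriv.ssubst {Γ Δ t u A B} (d : Deriv Γ (some A) t B) (e : Deriv Γ Δ u (.comp A)) :
    Nonempty (Deriv Γ Δ (ssubst u t) B) := by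
  rw [ssubst_eq_msub]
  exact d.msub (.var Γ) ⟨e⟩

/-- Both sides of a provable equation are well typed. -/
theorem EEq.deriv {Γ Δ t u A} (h : EEq Γ Δ t u A) :
    Nonempty (Deriv Γ Δ t A) ∧ Nonempty (Deriv Γ Δ u A) := by
  induction h with
  | refl d => exact ⟨⟨d⟩, ⟨d⟩⟩
  | symm _ h => exact h.symm
  | trans _ _ h1 h2 => exact ⟨h1.1, h2.2⟩
  | vpair_cong _ _ h1 h2 =>
    exact ⟨⟨.vpair _ _ _ _ _ h1.1.some h2.1.some⟩,
      ⟨.vpair _ _ _ _ _ h1.2.some h2.2.some⟩⟩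
  | vfst_cong _ h =>
    exact ⟨⟨.vfst _ _ _ _ h.1.some⟩,
      ⟨.vfst _ _ _ _ h.2.some⟩⟩
  | vsnd_cong _ h =>
    exact ⟨⟨.vsnd _ _ _ _ h.1.some⟩,
      ⟨.vsnd _ _ _ _ h.2.some⟩⟩
  | vlam_cong _ h =>
    exact ⟨⟨.vlam _ _ _ _ h.1.some⟩,
      ⟨.vlam _ _ _ _ h.2.some⟩⟩
  | vapp_cong _ _ h1 h2 =>
    exact ⟨⟨.vapp _ _ _ _ _ h1.1.some h2.1.some⟩,
      ⟨.vapp _ _ _ _ _ h1.2.some h2.2.some⟩⟩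
  | cpair_cong _ _ h1 h2 =>
    exact ⟨⟨.cpair _ _ _ _ _ _ h1.1.some h2.1.some⟩,
      ⟨.cpair _ _ _ _ _ _ h1.2.some h2.2.some⟩⟩
  | cfst_cong _ h =>
    exact ⟨⟨.cfst _ _ _ _ _ h.1.some⟩,
      ⟨.cfst _ _ _ _ _ h.2.some⟩⟩
  | csnd_cong _ h =>
    exact ⟨⟨.csnd _ _ _ _ _ h.1.some⟩,
      ⟨.csnd _ _ _ _ _ h.2.some⟩⟩
  | clam_cong _ h =>
    exact ⟨⟨.clam _ _ _ _ _ h.1.some⟩,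
      ⟨.clam _ _ _ _ _ h.2.some⟩⟩
  | capp_cong _ _ h1 h2 =>
    exact ⟨⟨.capp _ _ _ _ _ _ h1.1.some h2.1.some⟩,
      ⟨.capp _ _ _ _ _ _ h1.2.some h2.2.some⟩⟩
  | ilet_cong _ _ h1 h2 =>
    exact ⟨⟨.ilet _ _ _ _ _ h1.1.some h2.1.some⟩,
      ⟨.ilet _ _ _ _ _ h1.2.some h2.2.some⟩⟩
  | bang_cong _ h =>
    exact ⟨⟨.bang _ _ _ h.1.some⟩,
      ⟨.bang _ _ _ h.2.some⟩⟩
  | banglet_cong _ _ h1 h2 =>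
    exact ⟨⟨.banglet _ _ _ _ _ _ h1.1.some h2.1.some⟩,
      ⟨.banglet _ _ _ _ _ _ h1.2.some h2.2.some⟩⟩
  | copow_cong _ _ h1 h2 =>
    exact ⟨⟨.copow _ _ _ _ _ _ h1.1.some h2.1.some⟩,
      ⟨.copow _ _ _ _ _ _ h1.2.some h2.2.some⟩⟩
  | copowlet_cong _ _ h1 h2 =>
    exact ⟨⟨.copowlet _ _ _ _ _ _ _ h1.1.some h2.1.some⟩,
      ⟨.copowlet _ _ _ _ _ _ _ h1.2.some h2.2.some⟩⟩
  | cimage_cong _ h =>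
    exact ⟨⟨.cimage _ _ _ _ h.1.some⟩,
      ⟨.cimage _ _ _ _ h.2.some⟩⟩
  | cinl_cong _ h =>
    exact ⟨⟨.cinl _ _ _ _ _ h.1.some⟩,
      ⟨.cinl _ _ _ _ _ h.2.some⟩⟩
  | cinr_cong _ h =>
    exact ⟨⟨.cinr _ _ _ _ _ h.1.some⟩,
      ⟨.cinr _ _ _ _ _ h.2.some⟩⟩
  | ccase_cong _ _ _ h1 h2 h3 =>
    exact ⟨⟨.ccase _ _ _ _ _ _ _ _ h1.1.some h2.1.some h3.1.some⟩,
      ⟨.ccase _ _ _ _ _ _ _ _ h1.2.some h2.2.some h3.2.some⟩⟩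
  | llam_cong _ h =>
    exact ⟨⟨.llam _ _ _ _ h.1.some⟩,
      ⟨.llam _ _ _ _ h.2.some⟩⟩
  | lapp_cong _ _ h1 h2 =>
    exact ⟨⟨.lapp _ _ _ _ _ _ h1.1.some h2.1.some⟩,
      ⟨.lapp _ _ _ _ _ _ h1.2.some h2.2.some⟩⟩
  | unit_eta d => exact ⟨⟨d⟩, ⟨.unit _⟩⟩
  | vfst_beta d e => exact ⟨⟨.vfst _ _ _ _ (.vpair _ _ _ _ _ d e)⟩, ⟨d⟩⟩
  | vsnd_beta d e => exact ⟨⟨.vsnd _ _ _ _ (.vpair _ _ _ _ _ d e)⟩, ⟨e⟩⟩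
  | vpair_eta d => exact ⟨⟨.vpair _ _ _ _ _ (.vfst _ _ _ _ d) (.vsnd _ _ _ _ d)⟩, ⟨d⟩⟩
  | vlam_beta d e => exact ⟨⟨.vapp _ _ _ _ _ (.vlam _ _ _ _ d) e⟩, d.subst0 e⟩
  | vlam_eta d =>
    exact ⟨⟨.vlam _ _ _ _ (.vapp _ _ _ _ _ (d.rename (.succ _ _)).some (.var _ 0 _ rfl))⟩, ⟨d⟩⟩
  | cunit_eta d => exact ⟨⟨d⟩, ⟨.cunit _ _⟩⟩
  | cfst_beta d e => exact ⟨⟨.cfst _ _ _ _ _ (.cpair _ _ _ _ _ _ d e)⟩, ⟨d⟩⟩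
  | csnd_beta d e => exact ⟨⟨.csnd _ _ _ _ _ (.cpair _ _ _ _ _ _ d e)⟩, ⟨e⟩⟩
  | cpair_eta d => exact ⟨⟨.cpair _ _ _ _ _ _ (.cfst _ _ _ _ _ d) (.csnd _ _ _ _ _ d)⟩, ⟨d⟩⟩
  | clam_beta d e => exact ⟨⟨.capp _ _ _ _ _ _ (.clam _ _ _ _ _ d) e⟩, d.subst0 e⟩
  | clam_eta d =>
    exact ⟨⟨.clam _ _ _ _ _ (.capp _ _ _ _ _ _ (d.rename (.succ _ _)).some (.var _ 0 _ rfl))⟩, ⟨d⟩⟩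
  | ilet_beta d => exact ⟨⟨.ilet _ _ _ _ _ (.top _) d⟩, ⟨d⟩⟩
  | ilet_eta d e => exact ⟨⟨.ilet _ _ _ _ _ d (e.ssubst (.top _)).some⟩, e.ssubst d⟩
  | bang_beta d e => exact ⟨⟨.banglet _ _ _ _ _ _ (.bang _ _ _ d) e⟩, e.subst0 d⟩
  | bang_eta d e =>
    exact ⟨⟨.banglet _ _ _ _ _ _ d
      ((e.rename (.succ _ _)).some.ssubst (.bang _ _ _ (.var _ 0 _ rfl))).some⟩, e.ssubst d⟩
  | copow_beta d e f =>
    exact ⟨⟨.copowlet _ _ _ _ _ _ _ (.copow _ _ _ _ _ _ d e) f⟩, (f.subst0 d).some.ssubst e⟩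
  | copow_eta d e =>
    exact ⟨⟨.copowlet _ _ _ _ _ _ _ d ((e.rename (.succ _ _)).some.ssubst
      (.copow _ _ _ _ _ _ (.var _ 0 _ rfl) (.svar _ _))).some⟩, e.ssubst d⟩
  | czero_eta d e => exact ⟨⟨.cimage _ _ _ _ d⟩, e.ssubst d⟩
  | csum_beta_inl d e f =>
    exact ⟨⟨.ccase _ _ _ _ _ _ _ _ (.cinl _ _ _ _ _ f) d e⟩, d.ssubst f⟩
  | csum_beta_inr d e f =>
    exact ⟨⟨.ccase _ _ _ _ _ _ _ _ (.cinr _ _ _ _ _ f) d e⟩, e.ssubst f⟩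
  | csum_eta d e =>
    exact ⟨⟨.ccase _ _ _ _ _ _ _ _ d (e.ssubst (.cinl _ _ _ _ _ (.svar _ _))).some
      (e.ssubst (.cinr _ _ _ _ _ (.svar _ _))).some⟩, e.ssubst d⟩
  | llam_beta d e => exact ⟨⟨.lapp _ _ _ _ _ _ (.llam _ _ _ _ d) e⟩, d.ssubst e⟩
  | llam_eta d => exact ⟨⟨.llam _ _ _ _ (.lapp _ _ _ _ _ _ d (.svar _ _))⟩, ⟨d⟩⟩

/-! ## Weak head reduction -/

/-- Weak head reduction of raw EEC terms. -/
inductive Step : Tm → Tm → Prop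
  | vfst_beta (t u : Tm) : Step (.vfst (.vpair t u)) t
  | vsnd_beta (t u : Tm) : Step (.vsnd (.vpair t u)) u
  | vapp_beta (A : VType) (t u : Tm) : Step (.vapp (.vlam A t) u) (Tm.subst0 u t)
  | cfst_beta (t u : Tm) : Step (.cfst (.cpair t u)) t
  | csnd_beta (t u : Tm) : Step (.csnd (.cpair t u)) u
  | capp_beta (A : VType) (t u : Tm) : Step (.capp (.clam A t) u) (Tm.subst0 u t)
  | ilet_beta (u : Tm) : Step (.ilet .top u) u
  | banglet_beta (t u : Tm) : Step (.banglet (.bang t) u) (Tm.subst0 t u)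
  | copowlet_beta (t s u : Tm) :
      Step (.copowlet (.copow t s) u) (Tm.ssubst s (Tm.subst0 t u))
  | ccase_inl (s t u : Tm) : Step (.ccase (.cinl s) t u) (Tm.ssubst s t)
  | ccase_inr (s t u : Tm) : Step (.ccase (.cinr s) t u) (Tm.ssubst s u)
  | lapp_beta (A : CType) (t u : Tm) : Step (.lapp (.llam A t) u) (Tm.ssubst u t)
  | vfst {t t' : Tm} : Step t t' → Step (.vfst t) (.vfst t')
  | vsnd {t t' : Tm} : Step t t' → Step (.vsnd t) (.vsnd t')
  | vapp {t t' : Tm} (u : Tm) : Step t t' → Step (.vapp t u) (.vapp t' u)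
  | cfst {t t' : Tm} : Step t t' → Step (.cfst t) (.cfst t')
  | csnd {t t' : Tm} : Step t t' → Step (.csnd t) (.csnd t')
  | capp {t t' : Tm} (u : Tm) : Step t t' → Step (.capp t u) (.capp t' u)
  | ilet {t t' : Tm} (u : Tm) : Step t t' → Step (.ilet t u) (.ilet t' u)
  | banglet {t t' : Tm} (u : Tm) : Step t t' → Step (.banglet t u) (.banglet t' u)
  | copowlet {t t' : Tm} (u : Tm) : Step t t' → Step (.copowlet t u) (.copowlet t' u)
  | ccase {s s' : Tm} (t u : Tm) : Step s s' → Step (.ccase s t u) (.ccase s' t u)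
  | lapp {s t : Tm} (u : Tm) : Step s t → Step (.lapp s u) (.lapp t u)

/-- The reflexive transitive closure of weak head reduction. -/
abbrev Steps : Tm → Tm → Prop := Relation.ReflTransGen Step

/-- Terms which do not reduce. -/
def Normal (t : Tm) : Prop := ∀ u, ¬ Step t u

theorem Step.deterministic {t u u' : Tm} (h : Step t u) (h' : Step t u') : u = u' := by
  induction h generalizing u' <;> cases h' <;>
    first
    | rfl
    | (rename_i h ih _ h'; exact congrArg _ (ih h'))
    | (rename_i h ih _ h'; rw [ih h'])
    | (rename_i h; cases h)
    | (rename_i h _; cases h)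

theorem Step.rename {t u : Tm} (h : Step t u) (f : ℕ → ℕ) : Step (t.rename f) (u.rename f) := by
  induction h <;> simp only [rename_subst0, rename_ssubst, Tm.rename] <;> constructor <;> assumption

theorem Steps.rename {t u : Tm} (h : Steps t u) (f : ℕ → ℕ) : Steps (t.rename f) (u.rename f) :=
  h.lift _ fun _ _ h => h.rename f

theorem Steps.eq_of_normal {t u : Tm} (h : Steps t u) (ht : Normal t) : u = t := by
  rcases h.cases_head with rfl | ⟨v, hv, _⟩
  · rfl
  · exact absurd hv (ht v)

theorem Steps.unique {t u u' : Tm} (h : Steps t u) (h' : Steps t u') (hu : Normal u)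
    (hu' : Normal u') : u = u' := by
  induction h using Relation.ReflTransGen.head_induction_on with
  | refl => exact (h'.eq_of_normal hu).symm
  | head hs _ ih =>
    rcases h'.cases_head with rfl | ⟨v, hv, h'⟩
    · exact absurd hs (hu' _)
    · exact ih (hs.deterministic hv ▸ h')

theorem normal_bang (t : Tm) : Normal (.bang t) := nofun
theorem normal_copow (t u : Tm) : Normal (.copow t u) := nofun
theorem normal_cinl (t : Tm) : Normal (.cinl t) := nofun
theorem normal_cinr (t : Tm) : Normal (.cinr t) := nofun

theorem Step.eEq {t u : Tm} (h : Step t u) {Γ Δ A} (d : Deriv Γ Δ t A) : EEq Γ Δ t u A := by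
  induction h generalizing Γ Δ A with
  | vfst_beta => cases d with | vfst _ _ _ _ d => cases d; exact .vfst_beta ‹_› ‹_›
  | vsnd_beta => cases d with | vsnd _ _ _ _ d => cases d; exact .vsnd_beta ‹_› ‹_›
  | vapp_beta => cases d with | vapp _ _ _ _ _ d => cases d; exact .vlam_beta ‹_› ‹_›
  | cfst_beta => cases d with | cfst _ _ _ _ _ d => cases d; exact .cfst_beta ‹_› ‹_›
  | csnd_beta => cases d with | csnd _ _ _ _ _ d => cases d; exact .csnd_beta ‹_› ‹_›
  | capp_beta => cases d with | capp _ _ _ _ _ _ d => cases d; exact .clam_beta ‹_› ‹_›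
  | ilet_beta => cases d with | ilet _ _ _ _ _ d => cases d; exact .ilet_beta ‹_›
  | banglet_beta => cases d with | banglet _ _ _ _ _ _ d => cases d; exact .bang_beta ‹_› ‹_›
  | copowlet_beta =>
    cases d with | copowlet _ _ _ _ _ _ _ d => cases d; exact .copow_beta ‹_› ‹_› ‹_›
  | ccase_inl => cases d with | ccase _ _ _ _ _ _ _ _ d => cases d; exact .csum_beta_inl ‹_› ‹_› ‹_›
  | ccase_inr => cases d with | ccase _ _ _ _ _ _ _ _ d => cases d; exact .csum_beta_inr ‹_› ‹_› ‹_›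
  | lapp_beta => cases d with | lapp _ _ _ _ _ _ d => cases d; exact .llam_beta ‹_› ‹_›
  | vfst _ ih => cases d with | vfst _ _ _ _ d => exact .vfst_cong (ih d)
  | vsnd _ ih => cases d with | vsnd _ _ _ _ d => exact .vsnd_cong (ih d)
  | vapp _ _ ih => cases d with | vapp _ _ _ _ _ d e => exact .vapp_cong (ih d) (.refl e)
  | cfst _ ih => cases d with | cfst _ _ _ _ _ d => exact .cfst_cong (ih d)
  | csnd _ ih => cases d with | csnd _ _ _ _ _ d => exact .csnd_cong (ih d)
  | capp _ _ ih => cases d with | capp _ _ _ _ _ _ d e => exact .capp_cong (ih d) (.refl e)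
  | ilet _ _ ih => cases d with | ilet _ _ _ _ _ d e => exact .ilet_cong (ih d) (.refl e)
  | banglet _ _ ih =>
    cases d with | banglet _ _ _ _ _ _ d e => exact .banglet_cong (ih d) (.refl e)
  | copowlet _ _ ih =>
    cases d with | copowlet _ _ _ _ _ _ _ d e => exact .copowlet_cong (ih d) (.refl e)
  | ccase _ _ _ ih =>
    cases d with | ccase _ _ _ _ _ _ _ _ d e f => exact .ccase_cong (ih d) (.refl e) (.refl f)
  | lapp _ _ ih => cases d with | lapp _ _ _ _ _ _ d e => exact .lapp_cong (ih d) (.refl e)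

theorem Steps.eEq {t u : Tm} (h : Steps t u) {Γ Δ A} (d : Deriv Γ Δ t A) : EEq Γ Δ t u A := by
  induction h with
  | refl => exact .refl d
  | tail _ hs ih => exact ih.trans (hs.eEq ih.deriv.2.some)

/-! ## Substitution in λ-terms -/

namespace LTm

/-- Lift a parallel substitution under a binder. -/
def liftS (s : ℕ → LTm) : ℕ → LTm := fun n => match n with | 0 => .var 0 | m + 1 => shift (s m)

theorem psubst_lam (s : ℕ → LTm) (A : STy) (M : LTm) :
    psubst s (.lam A M) = .lam A (psubst (liftS s) M) := rfl

end LTm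

/-- `s` is a well-typed substitution from `Θ` to `Θ'`. -/
def LSubstTy (s : ℕ → LTm) (Θ Θ' : List STy) : Prop :=
  ∀ n A, Θ[n]? = some A → Nonempty (LDeriv Θ' (s n) A)

theorem LDeriv.rename {Θ M A} (d : LDeriv Θ M A) {f : ℕ → ℕ} {Θ' : List STy}
    (hf : Renaming f Θ Θ') : Nonempty (LDeriv Θ' (M.rename f) A) := by
  induction d generalizing f Θ' with
  | var _ n A h => exact ⟨.var _ _ _ (hf n A h)⟩
  | unit => exact ⟨.unit _⟩
  | pair _ _ _ _ _ _ _ h1 h2 => exact ⟨.pair _ _ _ _ _ (h1 hf).some (h2 hf).some⟩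
  | fst _ _ _ _ _ h => exact ⟨.fst _ _ _ _ (h hf).some⟩
  | snd _ _ _ _ _ h => exact ⟨.snd _ _ _ _ (h hf).some⟩
  | lam _ _ _ _ _ h => exact ⟨.lam _ _ _ _ (h (hf.liftN _)).some⟩
  | app _ _ _ _ _ _ _ h1 h2 => exact ⟨.app _ _ _ _ _ (h1 hf).some (h2 hf).some⟩

theorem LSubstTy.liftS {s Θ Θ'} (h : LSubstTy s Θ Θ') (A : STy) :
    LSubstTy (LTm.liftS s) (A :: Θ) (A :: Θ') := by
  rintro (_ | n) B hB
  · exact ⟨.var _ _ _ hB⟩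
  · exact (h n B (by simpa using hB)).some.rename (.succ Θ' A)

theorem LDeriv.psubst {Θ M A} (d : LDeriv Θ M A) {s : ℕ → LTm} {Θ' : List STy}
    (hs : LSubstTy s Θ Θ') : Nonempty (LDeriv Θ' (M.psubst s) A) := by
  induction d generalizing s Θ' with
  | var _ n A h => exact hs n A h
  | unit => exact ⟨.unit _⟩
  | pair _ _ _ _ _ _ _ h1 h2 => exact ⟨.pair _ _ _ _ _ (h1 hs).some (h2 hs).some⟩
  | fst _ _ _ _ _ h => exact ⟨.fst _ _ _ _ (h hs).some⟩
  | snd _ _ _ _ _ h => exact ⟨.snd _ _ _ _ (h hs).some⟩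
  | lam _ _ _ _ _ h => exact ⟨.lam _ _ _ _ (h (hs.liftS _)).some⟩
  | app _ _ _ _ _ _ _ h1 h2 => exact ⟨.app _ _ _ _ _ (h1 hs).some (h2 hs).some⟩

theorem LDeriv.subst0 {Θ M N A B} (d : LDeriv (A :: Θ) M B) (e : LDeriv Θ N A) :
    Nonempty (LDeriv Θ (LTm.subst0 N M) B) := by
  refine d.psubst ?_
  rintro (_ | n) C hC
  · obtain rfl : A = C := by simpa using hC
    exact ⟨e⟩
  · exact ⟨.var _ n C (by simpa using hC)⟩

/-- Both sides of a βη-equality are well typed. -/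
theorem LBetaEta.deriv {Θ M N A} (h : LBetaEta Θ M N A) :
    Nonempty (LDeriv Θ M A) ∧ Nonempty (LDeriv Θ N A) := by
  induction h with
  | refl d => exact ⟨⟨d⟩, ⟨d⟩⟩
  | symm _ h => exact h.symm
  | trans _ _ h1 h2 => exact ⟨h1.1, h2.2⟩
  | pair_cong _ _ h1 h2 =>
    exact ⟨⟨.pair _ _ _ _ _ h1.1.some h2.1.some⟩, ⟨.pair _ _ _ _ _ h1.2.some h2.2.some⟩⟩
  | fst_cong _ h => exact ⟨⟨.fst _ _ _ _ h.1.some⟩, ⟨.fst _ _ _ _ h.2.some⟩⟩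
  | snd_cong _ h => exact ⟨⟨.snd _ _ _ _ h.1.some⟩, ⟨.snd _ _ _ _ h.2.some⟩⟩
  | lam_cong _ h => exact ⟨⟨.lam _ _ _ _ h.1.some⟩, ⟨.lam _ _ _ _ h.2.some⟩⟩
  | app_cong _ _ h1 h2 =>
    exact ⟨⟨.app _ _ _ _ _ h1.1.some h2.1.some⟩, ⟨.app _ _ _ _ _ h1.2.some h2.2.some⟩⟩
  | beta d e => exact ⟨⟨.app _ _ _ _ _ (.lam _ _ _ _ d) e⟩, d.subst0 e⟩
  | eta d =>
    exact ⟨⟨.lam _ _ _ _ (.app _ _ _ _ _ (d.rename (.succ _ _)).some (.var _ 0 _ rfl))⟩, ⟨d⟩⟩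
  | fst_beta d e => exact ⟨⟨.fst _ _ _ _ (.pair _ _ _ _ _ d e)⟩, ⟨d⟩⟩
  | snd_beta d e => exact ⟨⟨.snd _ _ _ _ (.pair _ _ _ _ _ d e)⟩, ⟨e⟩⟩
  | pair_eta d => exact ⟨⟨.pair _ _ _ _ _ (.fst _ _ _ _ d) (.snd _ _ _ _ d)⟩, ⟨d⟩⟩
  | unit_eta d => exact ⟨⟨d⟩, ⟨.unit _⟩⟩

/-! ## Soundness of the call-by-name translation -/

theorem cbnTm_rename (f : ℕ → ℕ) (M : LTm) : cbnTm (M.rename f) = (cbnTm M).rename f := by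
  induction M generalizing f <;> simp_all [cbnTm, LTm.rename, Tm.rename]

theorem cbnTm_shift (M : LTm) : cbnTm M.shift = (cbnTm M).shift := cbnTm_rename _ M

theorem cbnTm_psubst (s : ℕ → LTm) (M : LTm) :
    cbnTm (M.psubst s) = (cbnTm M).psubst (cbnTm ∘ s) := by
  have hl : ∀ s, cbnTm ∘ LTm.liftS s = liftS (cbnTm ∘ s) := by
    intro s
    funext n
    cases n
    · rfl
    · exact cbnTm_shift _
  induction M generalizing s with
  | lam => simp_all [LTm.psubst_lam, cbnTm, Tm.psubst]
  | _ => simp_all [cbnTm, LTm.psubst, Tm.psubst]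

theorem cbnTm_subst0 (N M : LTm) : cbnTm (LTm.subst0 N M) = Tm.subst0 (cbnTm N) (cbnTm M) := by
  rw [LTm.subst0, cbnTm_psubst, Tm.subst0]
  congr 1
  funext n
  cases n <;> rfl

theorem cbnCtx_getElem? {Θ : List STy} {n : ℕ} {A : STy} (h : Θ[n]? = some A) :
    (cbnCtx Θ)[n]? = some (.comp (cbnT A)) := by
  simp [cbnCtx, h]

/-- The call-by-name translation preserves typing. -/
theorem LDeriv.cbn {Θ M A} (d : LDeriv Θ M A) :
    Nonempty (Deriv (cbnCtx Θ) none (cbnTm M) (.comp (cbnT A))) := by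
  induction d with
  | var _ n A h => exact ⟨.var _ _ _ (cbnCtx_getElem? h)⟩
  | unit => exact ⟨.cunit _ _⟩
  | pair _ _ _ _ _ _ _ h1 h2 => exact ⟨.cpair _ _ _ _ _ _ h1.some h2.some⟩
  | fst _ _ _ _ _ h => exact ⟨.cfst _ _ _ _ _ h.some⟩
  | snd _ _ _ _ _ h => exact ⟨.csnd _ _ _ _ _ h.some⟩
  | lam _ _ _ _ _ h => exact ⟨.clam _ _ _ _ _ h.some⟩
  | app _ _ _ _ _ _ _ h1 h2 => exact ⟨.capp _ _ _ _ _ _ h1.some h2.some⟩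

/-- Soundness: the call-by-name translation preserves equality. -/
theorem LBetaEta.cbn {Θ M N A} (h : LBetaEta Θ M N A) :
    EEq (cbnCtx Θ) none (cbnTm M) (cbnTm N) (.comp (cbnT A)) := by
  induction h with
  | refl d => exact .refl d.cbn.some
  | symm _ h => exact h.symm
  | trans _ _ h1 h2 => exact h1.trans h2
  | pair_cong _ _ h1 h2 => exact .cpair_cong h1 h2
  | fst_cong _ h => exact .cfst_cong h
  | snd_cong _ h => exact .csnd_cong h
  | lam_cong _ h => exact .clam_cong h
  | app_cong _ _ h1 h2 => exact .capp_cong h1 h2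
  | beta d e =>
    rw [cbnTm_subst0]
    exact .clam_beta d.cbn.some e.cbn.some
  | eta d =>
    simp only [cbnTm, cbnTm_shift]
    exact .clam_eta d.cbn.some
  | fst_beta d e => exact .cfst_beta d.cbn.some e.cbn.some
  | snd_beta d e => exact .csnd_beta d.cbn.some e.cbn.some
  | pair_eta d => exact .cpair_eta d.cbn.some
  | unit_eta d => exact .cunit_eta d.cbn.some

/-- Weak head reduction of the translation of a λ-term reflects into βη-equality. -/
theorem Step.of_cbnTm {M : LTm} {u : Tm} (h : Step (cbnTm M) u) {Θ A} (d : LDeriv Θ M A) :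
    ∃ N, cbnTm N = u ∧ LBetaEta Θ M N A := by
  induction d generalizing u with
  | var => cases h
  | unit => cases h
  | pair => cases h
  | lam => cases h
  | fst Θ M A B d ih =>
    generalize hM : cbnTm M = s at ih
    simp only [cbnTm, hM] at h
    cases h with
    | cfst_beta t u =>
      cases M <;> cases hM
      cases d with | pair _ _ _ _ _ d e => exact ⟨_, rfl, .fst_beta d e⟩
    | cfst h =>
      obtain ⟨N, rfl, hN⟩ := ih h
      exact ⟨.fst N, rfl, .fst_cong hN⟩
  | snd Θ M A B d ih =>
    generalize hM : cbnTm M = s at ih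
    simp only [cbnTm, hM] at h
    cases h with
    | csnd_beta t u =>
      cases M <;> cases hM
      cases d with | pair _ _ _ _ _ d e => exact ⟨_, rfl, .snd_beta d e⟩
    | csnd h =>
      obtain ⟨N, rfl, hN⟩ := ih h
      exact ⟨.snd N, rfl, .snd_cong hN⟩
  | app Θ M P A B d e ih =>
    generalize hM : cbnTm M = s at ih
    simp only [cbnTm, hM] at h
    cases h with
    | capp_beta C t u =>
      cases M <;> cases hM
      cases d with | lam _ _ _ _ d => exact ⟨_, cbnTm_subst0 _ _, .beta d e⟩
    | capp _ h =>
      obtain ⟨N, rfl, hN⟩ := ih h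
      exact ⟨.app N P, rfl, .app_cong hN (.refl e)⟩

theorem Steps.of_cbnTm {M : LTm} {u : Tm} (h : Steps (cbnTm M) u) {Θ A} (d : LDeriv Θ M A) :
    ∃ N, cbnTm N = u ∧ LBetaEta Θ M N A := by
  induction h with
  | refl => exact ⟨M, rfl, .refl d⟩
  | tail _ hs ih =>
    obtain ⟨N, rfl, hN⟩ := ih
    obtain ⟨P, rfl, hP⟩ := hs.of_cbnTm hN.deriv.2.some
    exact ⟨P, rfl, hN.trans hP⟩

/-! ## Reading back λ-terms -/

/-- Type-directed read-back of EEC terms into λ-terms: `ReadBack true Θ t M A` says that `t` is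
neutral and reads back as `M`, and `ReadBack false Θ t M A` that `t` has the η-long normal
form `M` at type `A`. -/
inductive ReadBack : Bool → List STy → Tm → LTm → STy → Prop
  | var {Θ n A} : Θ[n]? = some A → ReadBack true Θ (.var n) (.var n) A
  | fst {Θ t M A B} : ReadBack true Θ t M (.prod A B) → ReadBack true Θ (.cfst t) (.fst M) A
  | snd {Θ t M A B} : ReadBack true Θ t M (.prod A B) → ReadBack true Θ (.csnd t) (.snd M) B
  | app {Θ t u M N A B} : ReadBack true Θ t M (.arr A B) → ReadBack false Θ u N A →
      ReadBack true Θ (.capp t u) (.app M N) B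
  | base {Θ t u M a} : Steps t u → ReadBack true Θ u M (.base a) →
      ReadBack false Θ t M (.base a)
  | unit {Θ t} : ReadBack false Θ t .unit .unit
  | pair {Θ t M N A B} : ReadBack false Θ (.cfst t) M A → ReadBack false Θ (.csnd t) N B →
      ReadBack false Θ t (.pair M N) (.prod A B)
  | lam {Θ t M A B} : ReadBack false (A :: Θ) (.capp (Tm.shift t) (.var 0)) M B →
      ReadBack false Θ t (.lam A M) (.arr A B)

namespace ReadBack

theorem rename {ne Θ t M A} (h : ReadBack ne Θ t M A) {f : ℕ → ℕ} {Θ' : List STy}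
    (hf : Renaming f Θ Θ') : ReadBack ne Θ' (t.rename f) (M.rename f) A := by
  induction h generalizing f Θ' with
  | var h => exact .var (hf _ _ h)
  | fst _ ih => exact .fst (ih hf)
  | snd _ ih => exact .snd (ih hf)
  | app _ _ ih1 ih2 => exact .app (ih1 hf) (ih2 hf)
  | base hs _ ih => exact .base (hs.rename f) (ih hf)
  | unit => exact .unit
  | pair _ _ ih1 ih2 => exact .pair (ih1 hf) (ih2 hf)
  | lam _ ih =>
    have := ih (hf.liftN _)
    simp only [Tm.rename, rename_liftN_shift] at this
    exact .lam this

theorem normal {Θ t M A} (h : ReadBack true Θ t M A) : Normal t := by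
  generalize hne : true = ne at h
  induction h with
  | var => nofun
  | fst h ih =>
    rintro _ (_ | _ | hs)
    · cases h
    · exact ih hne _ ‹_›
  | snd h ih =>
    rintro _ (_ | _ | hs)
    · cases h
    · exact ih hne _ ‹_›
  | app h _ ih =>
    rintro _ (_ | _ | hs)
    · cases h
    · exact ih hne _ ‹_›
  | _ => cases hne

theorem unique {ne Θ t M M' A A'} (h : ReadBack ne Θ t M A) (h' : ReadBack ne Θ t M' A')
    (hA : ne = false → A = A') : M = M' ∧ A = A' := by
  induction h generalizing M' A' with
  | var h =>
    cases h' with | var h' => exact ⟨rfl, Option.some_inj.1 (h.symm.trans h')⟩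
  | fst _ ih =>
    cases h' with | fst h' =>
    obtain ⟨rfl, h⟩ := ih h' nofun
    cases h
    exact ⟨rfl, rfl⟩
  | snd _ ih =>
    cases h' with | snd h' =>
    obtain ⟨rfl, h⟩ := ih h' nofun
    cases h
    exact ⟨rfl, rfl⟩
  | app _ _ ih1 ih2 =>
    cases h' with | app h' h'' =>
    obtain ⟨rfl, h⟩ := ih1 h' nofun
    cases h
    obtain ⟨rfl, -⟩ := ih2 h'' fun _ => rfl
    exact ⟨rfl, rfl⟩
  | base hs h ih =>
    cases hA rfl
    cases h' with | base hs' h' =>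
    cases hs.unique hs' h.normal h'.normal
    exact ⟨(ih h' nofun).1, rfl⟩
  | unit =>
    cases hA rfl
    cases h'
    exact ⟨rfl, rfl⟩
  | pair _ _ ih1 ih2 =>
    cases hA rfl
    cases h' with | pair h' h'' =>
    obtain ⟨rfl, -⟩ := ih1 h' fun _ => rfl
    obtain ⟨rfl, -⟩ := ih2 h'' fun _ => rfl
    exact ⟨rfl, rfl⟩
  | lam _ ih =>
    cases hA rfl
    cases h' with | lam h' =>
    obtain ⟨rfl, -⟩ := ih h' fun _ => rfl
    exact ⟨rfl, rfl⟩

theorem expand {Θ s t M A} (hs : Steps s t) (h : ReadBack false Θ t M (.base A)) :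
    ReadBack false Θ s M (.base A) := by
  cases h with | base h hM => exact .base (hs.trans h) hM

/-- Read-back of a well-typed EEC term yields a well-typed λ-term whose translation is equal to
the given term. -/
theorem eEq {ne Θ t M A} (h : ReadBack ne Θ t M A) {C : VType}
    (d : Deriv (cbnCtx Θ) none t C) (hC : ne = false → C = .comp (cbnT A)) :
    C = .comp (cbnT A) ∧ Nonempty (LDeriv Θ M A) ∧
      EEq (cbnCtx Θ) none (cbnTm M) t (.comp (cbnT A)) := by
  induction h generalizing C with
  | var h =>
    cases d with | var _ _ _ h' =>
    obtain rfl := Option.some_inj.1 (h'.symm.trans (cbnCtx_getElem? h))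
    exact ⟨rfl, ⟨.var _ _ _ h⟩, .refl (.var _ _ _ h')⟩
  | fst _ ih =>
    cases d with | cfst _ _ _ _ _ d =>
    obtain ⟨h, e, q⟩ := ih d nofun
    cases h
    exact ⟨rfl, ⟨.fst _ _ _ _ e.some⟩, .cfst_cong q⟩
  | snd _ ih =>
    cases d with | csnd _ _ _ _ _ d =>
    obtain ⟨h, e, q⟩ := ih d nofun
    cases h
    exact ⟨rfl, ⟨.snd _ _ _ _ e.some⟩, .csnd_cong q⟩
  | app _ _ ih1 ih2 =>
    cases d with | capp _ _ _ _ _ _ d d' =>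
    obtain ⟨h, e, q⟩ := ih1 d nofun
    cases h
    obtain ⟨-, e', q'⟩ := ih2 d' fun _ => rfl
    exact ⟨rfl, ⟨.app _ _ _ _ _ e.some e'.some⟩, .capp_cong q q'⟩
  | base hs _ ih =>
    cases hC rfl
    have q := hs.eEq d
    obtain ⟨-, e, q'⟩ := ih q.deriv.2.some nofun
    exact ⟨rfl, e, q'.trans q.symm⟩
  | unit =>
    cases hC rfl
    exact ⟨rfl, ⟨.unit _⟩, .symm (.cunit_eta d)⟩
  | pair _ _ ih1 ih2 =>
    cases hC rfl
    obtain ⟨-, e, q⟩ := ih1 (.cfst _ _ _ _ _ d) fun _ => rfl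
    obtain ⟨-, e', q'⟩ := ih2 (.csnd _ _ _ _ _ d) fun _ => rfl
    exact ⟨rfl, ⟨.pair _ _ _ _ _ e.some e'.some⟩, .trans (.cpair_cong q q') (.cpair_eta d)⟩
  | lam _ ih =>
    cases hC rfl
    obtain ⟨-, e, q⟩ := ih (.capp _ _ _ _ _ _ (d.rename (.succ _ _)).some (.var _ 0 _ rfl))
      fun _ => rfl
    exact ⟨rfl, ⟨.lam _ _ _ _ e.some⟩, .trans (.clam_cong q) (.clam_eta d)⟩

/-- Read-back of the translation of a λ-term is βη-equal to the given term. -/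
theorem lBetaEta {ne Θ t P A} (h : ReadBack ne Θ t P A) {M : LTm} {C : STy}
    (d : LDeriv Θ M C) (ht : cbnTm M = t) (hC : ne = false → C = A) :
    C = A ∧ LBetaEta Θ M P A := by
  induction h generalizing M C with
  | var h =>
    cases M <;> cases ht
    cases d with | var _ _ _ h' =>
    obtain rfl := Option.some_inj.1 (h'.symm.trans h)
    exact ⟨rfl, .refl (.var _ _ _ h)⟩
  | fst _ ih =>
    cases M <;> cases ht
    cases d with | fst _ _ _ _ d =>
    obtain ⟨h, q⟩ := ih d rfl nofun
    cases h
    exact ⟨rfl, .fst_cong q⟩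
  | snd _ ih =>
    cases M <;> cases ht
    cases d with | snd _ _ _ _ d =>
    obtain ⟨h, q⟩ := ih d rfl nofun
    cases h
    exact ⟨rfl, .snd_cong q⟩
  | app _ _ ih1 ih2 =>
    cases M <;> cases ht
    cases d with | app _ _ _ _ _ d d' =>
    obtain ⟨h, q⟩ := ih1 d rfl nofun
    cases h
    exact ⟨rfl, .app_cong q (ih2 d' rfl fun _ => rfl).2⟩
  | base hs _ ih =>
    cases hC rfl
    subst ht
    obtain ⟨N, rfl, q⟩ := hs.of_cbnTm d
    exact ⟨rfl, q.trans (ih q.deriv.2.some rfl nofun).2⟩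
  | unit =>
    cases hC rfl
    exact ⟨rfl, .unit_eta d⟩
  | pair _ _ ih1 ih2 =>
    cases hC rfl
    subst ht
    exact ⟨rfl, .trans (.symm (.pair_eta d)) (.pair_cong
      (ih1 (.fst _ _ _ _ d) rfl fun _ => rfl).2 (ih2 (.snd _ _ _ _ d) rfl fun _ => rfl).2)⟩
  | lam _ ih =>
    cases hC rfl
    subst ht
    refine ⟨rfl, .trans (.symm (.eta d)) (.lam_cong (ih (.app _ _ _ _ _
      (d.rename (.succ _ _)).some (.var _ 0 _ rfl)) ?_ fun _ => rfl).2)⟩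
    exact congrArg (Tm.capp · (.var 0)) (cbnTm_shift _)

end ReadBack

/-! ## The logical relation -/

mutual
  /-- The Kripke logical relation at value types. -/
  def RV : VType → List STy → Tm → Tm → Prop
    | .base _ => fun _ _ _ => True
    | .unit => fun _ _ _ => True
    | .prod A B => fun Θ t t' => RV A Θ (.vfst t) (.vfst t') ∧ RV B Θ (.vsnd t) (.vsnd t')
    | .arr A B => fun Θ t t' => ∀ (Θ' : List STy) (f : ℕ → ℕ), Renaming f Θ Θ' →
        ∀ a a', StoupFree a → StoupFree a' → RV A Θ' a a' →
          RV B Θ' (.vapp (t.rename f) a) (.vapp (t'.rename f) a')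
    | .comp A => RC A
    | .lin A B => fun Θ t t' => ∀ (Θ' : List STy) (f : ℕ → ℕ), Renaming f Θ Θ' →
        ∀ a b, RC A Θ' a b → RC B Θ' (.lapp (t.rename f) a) (.lapp (t'.rename f) b)
  /-- The Kripke logical relation at computation types. -/
  def RC : CType → List STy → Tm → Tm → Prop
    | .base 0 => fun _ _ _ => True
    | .base (a + 1) => fun Θ t t' =>
        ∃ M, ReadBack false Θ t M (.base a) ∧ ReadBack false Θ t' M (.base a)
    | .cunit => fun _ _ _ => True
    | .cand A B => fun Θ t t' => RC A Θ (.cfst t) (.cfst t') ∧ RC B Θ (.csnd t) (.csnd t')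
    | .carr A B => fun Θ t t' => ∀ (Θ' : List STy) (f : ℕ → ℕ), Renaming f Θ Θ' →
        ∀ a a', StoupFree a → StoupFree a' → RV A Θ' a a' →
          RC B Θ' (.capp (t.rename f) a) (.capp (t'.rename f) a')
    | .iunit => fun _ t t' => Steps t .top ∧ Steps t' .top
    | .bang A => fun Θ t t' => ∃ a a', Steps t (.bang a) ∧ Steps t' (.bang a') ∧
        StoupFree a ∧ StoupFree a' ∧ RV A Θ a a'
    | .copow A B => fun Θ t t' => ∃ a a' s s', Steps t (.copow a s) ∧ Steps t' (.copow a' s') ∧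
        StoupFree a ∧ StoupFree a' ∧ RV A Θ a a' ∧ RC B Θ s s'
    | .czero => fun _ _ _ => False
    | .csum A B => fun Θ t t' =>
        (∃ s s', Steps t (.cinl s) ∧ Steps t' (.cinl s') ∧ RC A Θ s s') ∨
        (∃ s s', Steps t (.cinr s) ∧ Steps t' (.cinr s') ∧ RC B Θ s s')
end

mutual
  theorem RV.expand (A : VType) {Θ : List STy} {s t s' t' : Tm} (hs : Steps s t)
      (hs' : Steps s' t') (h : RV A Θ t t') : RV A Θ s s' := by
    cases A with
    | base => trivial
    | unit => trivial
    | prod A B =>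
      exact ⟨RV.expand A (hs.lift _ fun _ _ => .vfst) (hs'.lift _ fun _ _ => .vfst) h.1,
        RV.expand B (hs.lift _ fun _ _ => .vsnd) (hs'.lift _ fun _ _ => .vsnd) h.2⟩
    | arr A B =>
      intro Θ' f hf a a' ha ha' hr
      exact RV.expand B ((hs.rename f).lift (Tm.vapp · a) fun _ _ => .vapp a)
        ((hs'.rename f).lift (Tm.vapp · a') fun _ _ => .vapp a') (h Θ' f hf a a' ha ha' hr)
    | comp A => exact RC.expand A hs hs' h
    | lin A B =>
      intro Θ' f hf a a' hr
      exact RC.expand B ((hs.rename f).lift (Tm.lapp · a) fun _ _ => .lapp a)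
        ((hs'.rename f).lift (Tm.lapp · a') fun _ _ => .lapp a') (h Θ' f hf a a' hr)
  /-- The logical relation is closed under head expansion. -/
  theorem RC.expand (A : CType) {Θ : List STy} {s t s' t' : Tm} (hs : Steps s t)
      (hs' : Steps s' t') (h : RC A Θ t t') : RC A Θ s s' := by
    match A with
    | .base 0 => trivial
    | .base (a + 1) =>
      obtain ⟨M, h, h'⟩ := h
      exact ⟨M, h.expand hs, h'.expand hs'⟩
    | .cunit => trivial
    | .cand A B =>
      exact ⟨RC.expand A (hs.lift _ fun _ _ => .cfst) (hs'.lift _ fun _ _ => .cfst) h.1,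
        RC.expand B (hs.lift _ fun _ _ => .csnd) (hs'.lift _ fun _ _ => .csnd) h.2⟩
    | .carr A B =>
      intro Θ' f hf a a' ha ha' hr
      exact RC.expand B ((hs.rename f).lift (Tm.capp · a) fun _ _ => .capp a)
        ((hs'.rename f).lift (Tm.capp · a') fun _ _ => .capp a') (h Θ' f hf a a' ha ha' hr)
    | .iunit => exact ⟨hs.trans h.1, hs'.trans h.2⟩
    | .bang A =>
      obtain ⟨a, a', h, h', r⟩ := h
      exact ⟨a, a', hs.trans h, hs'.trans h', r⟩
    | .copow A B =>
      obtain ⟨a, a', c, c', h, h', r⟩ := h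
      exact ⟨a, a', c, c', hs.trans h, hs'.trans h', r⟩
    | .czero => exact h
    | .csum A B =>
      exact h.imp (fun ⟨c, c', h, h', r⟩ => ⟨c, c', hs.trans h, hs'.trans h', r⟩)
        (fun ⟨c, c', h, h', r⟩ => ⟨c, c', hs.trans h, hs'.trans h', r⟩)
end

mutual
  theorem RV.symm (A : VType) {Θ : List STy} {t t' : Tm} (h : RV A Θ t t') : RV A Θ t' t := by
    cases A with
    | base => trivial
    | unit => trivial
    | prod A B => exact ⟨RV.symm A h.1, RV.symm B h.2⟩
    | arr A B =>
      exact fun Θ' f hf a a' ha ha' hr => RV.symm B (h Θ' f hf a' a ha' ha (RV.symm A hr))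
    | comp A => exact RC.symm A h
    | lin A B => exact fun Θ' f hf a a' hr => RC.symm B (h Θ' f hf a' a (RC.symm A hr))
  theorem RC.symm (A : CType) {Θ : List STy} {t t' : Tm} (h : RC A Θ t t') : RC A Θ t' t := by
    match A with
    | .base 0 => trivial
    | .base (a + 1) =>
      obtain ⟨M, h, h'⟩ := h
      exact ⟨M, h', h⟩
    | .cunit => trivial
    | .cand A B => exact ⟨RC.symm A h.1, RC.symm B h.2⟩
    | .carr A B =>
      exact fun Θ' f hf a a' ha ha' hr => RC.symm B (h Θ' f hf a' a ha' ha (RV.symm A hr))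
    | .iunit => exact ⟨h.2, h.1⟩
    | .bang A =>
      obtain ⟨a, a', h, h', f, f', r⟩ := h
      exact ⟨a', a, h', h, f', f, RV.symm A r⟩
    | .copow A B =>
      obtain ⟨a, a', c, c', h, h', f, f', r, q⟩ := h
      exact ⟨a', a, c', c, h', h, f', f, RV.symm A r, RC.symm B q⟩
    | .czero => exact h
    | .csum A B =>
      exact h.imp (fun ⟨c, c', h, h', r⟩ => ⟨c', c, h', h, RC.symm A r⟩)
        (fun ⟨c, c', h, h', r⟩ => ⟨c', c, h', h, RC.symm B r⟩)
end

mutual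
  theorem RV.trans (A : VType) {Θ : List STy} {t t' t'' : Tm} (h : RV A Θ t t')
      (h' : RV A Θ t' t'') : RV A Θ t t'' := by
    cases A with
    | base => trivial
    | unit => trivial
    | prod A B => exact ⟨RV.trans A h.1 h'.1, RV.trans B h.2 h'.2⟩
    | arr A B =>
      exact fun Θ' f hf a a' ha ha' hr => RV.trans B
        (h Θ' f hf a a ha ha (RV.trans A hr (RV.symm A hr))) (h' Θ' f hf a a' ha ha' hr)
    | comp A => exact RC.trans A h h'
    | lin A B =>
      exact fun Θ' f hf a a' hr => RC.trans B
        (h Θ' f hf a a (RC.trans A hr (RC.symm A hr))) (h' Θ' f hf a a' hr)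
  theorem RC.trans (A : CType) {Θ : List STy} {t t' t'' : Tm} (h : RC A Θ t t')
      (h' : RC A Θ t' t'') : RC A Θ t t'' := by
    match A with
    | .base 0 => trivial
    | .base (a + 1) =>
      obtain ⟨M, h, hm⟩ := h
      obtain ⟨N, hn, h'⟩ := h'
      obtain ⟨rfl, -⟩ := hm.unique hn fun _ => rfl
      exact ⟨M, h, h'⟩
    | .cunit => trivial
    | .cand A B => exact ⟨RC.trans A h.1 h'.1, RC.trans B h.2 h'.2⟩
    | .carr A B =>
      exact fun Θ' f hf a a' ha ha' hr => RC.trans B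
        (h Θ' f hf a a ha ha (RV.trans A hr (RV.symm A hr))) (h' Θ' f hf a a' ha ha' hr)
    | .iunit => exact ⟨h.1, h'.2⟩
    | .bang A =>
      obtain ⟨a, a', h, hm, f, f', r⟩ := h
      obtain ⟨b, b', hn, h', g, g', r'⟩ := h'
      cases hm.unique hn (normal_bang _) (normal_bang _)
      exact ⟨a, b', h, h', f, g', RV.trans A r r'⟩
    | .copow A B =>
      obtain ⟨a, a', c, c', h, hm, f, f', r, q⟩ := h
      obtain ⟨b, b', d, d', hn, h', g, g', r', q'⟩ := h'
      cases hm.unique hn (normal_copow _ _) (normal_copow _ _)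
      exact ⟨a, b', c, d', h, h', f, g', RV.trans A r r', RC.trans B q q'⟩
    | .czero => exact h
    | .csum A B =>
      rcases h with ⟨c, c', h, hm, r⟩ | ⟨c, c', h, hm, r⟩ <;>
        rcases h' with ⟨d, d', hn, h', r'⟩ | ⟨d, d', hn, h', r'⟩
      · cases hm.unique hn (normal_cinl _) (normal_cinl _)
        exact .inl ⟨c, d', h, h', RC.trans A r r'⟩
      · cases hm.unique hn (normal_cinl _) (normal_cinr _)
      · cases hm.unique hn (normal_cinr _) (normal_cinl _)
      · cases hm.unique hn (normal_cinr _) (normal_cinr _)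
        exact .inr ⟨c, d', h, h', RC.trans B r r'⟩
end

mutual
  theorem RV.mono (A : VType) {Θ Θ' : List STy} {f : ℕ → ℕ} (hf : Renaming f Θ Θ') {t t' : Tm}
      (h : RV A Θ t t') : RV A Θ' (t.rename f) (t'.rename f) := by
    cases A with
    | base => trivial
    | unit => trivial
    | prod A B => exact ⟨RV.mono A hf h.1, RV.mono B hf h.2⟩
    | arr A B =>
      intro Θ'' g hg a a' ha ha' hr
      simp only [rename_rename]
      exact h Θ'' (g ∘ f) (hg.comp hf) a a' ha ha' hr
    | comp A => exact RC.mono A hf h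
    | lin A B =>
      intro Θ'' g hg a a' hr
      simp only [rename_rename]
      exact h Θ'' (g ∘ f) (hg.comp hf) a a' hr
  /-- The logical relation is stable under renaming. -/
  theorem RC.mono (A : CType) {Θ Θ' : List STy} {f : ℕ → ℕ} (hf : Renaming f Θ Θ') {t t' : Tm}
      (h : RC A Θ t t') : RC A Θ' (t.rename f) (t'.rename f) := by
    match A with
    | .base 0 => trivial
    | .base (a + 1) =>
      obtain ⟨M, h, h'⟩ := h
      exact ⟨_, h.rename hf, h'.rename hf⟩
    | .cunit => trivial
    | .cand A B => exact ⟨RC.mono A hf h.1, RC.mono B hf h.2⟩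
    | .carr A B =>
      intro Θ'' g hg a a' ha ha' hr
      simp only [rename_rename]
      exact h Θ'' (g ∘ f) (hg.comp hf) a a' ha ha' hr
    | .iunit => exact ⟨h.1.rename f, h.2.rename f⟩
    | .bang A =>
      obtain ⟨a, a', h, h', g, g', r⟩ := h
      exact ⟨_, _, h.rename f, h'.rename f, g.rename f, g'.rename f, RV.mono A hf r⟩
    | .copow A B =>
      obtain ⟨a, a', c, c', h, h', g, g', r, q⟩ := h
      exact ⟨_, _, _, _, h.rename f, h'.rename f, g.rename f, g'.rename f, RV.mono A hf r,
        RC.mono B hf q⟩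
    | .czero => exact h
    | .csum A B =>
      exact h.imp (fun ⟨c, c', h, h', r⟩ => ⟨_, _, h.rename f, h'.rename f, RC.mono A hf r⟩)
        (fun ⟨c, c', h, h', r⟩ => ⟨_, _, h.rename f, h'.rename f, RC.mono B hf r⟩)
end

mutual
  /-- Neutral terms with a common read-back are related. -/
  theorem RC.reflect (A : STy) {Θ : List STy} {t t' : Tm} {M : LTm} (h : ReadBack true Θ t M A)
      (h' : ReadBack true Θ t' M A) : RC (cbnT A) Θ t t' := by
    match A with
    | .base a => exact ⟨M, .base .refl h, .base .refl h'⟩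
    | .unit => trivial
    | .prod A B => exact ⟨RC.reflect A (.fst h) (.fst h'), RC.reflect B (.snd h) (.snd h')⟩
    | .arr A B =>
      intro Θ' f hf a a' _ _ hr
      obtain ⟨N, ha, hb⟩ := RC.reify A hr
      exact RC.reflect B (.app (h.rename hf) ha) (.app (h'.rename hf) hb)
  /-- Related terms have a common read-back. -/
  theorem RC.reify (A : STy) {Θ : List STy} {t t' : Tm} (h : RC (cbnT A) Θ t t') :
      ∃ M, ReadBack false Θ t M A ∧ ReadBack false Θ t' M A := by
    match A with
    | .base a => exact h
    | .unit => exact ⟨.unit, .unit, .unit⟩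
    | .prod A B =>
      obtain ⟨M, hM, hM'⟩ := RC.reify A h.1
      obtain ⟨N, hN, hN'⟩ := RC.reify B h.2
      exact ⟨_, .pair hM hN, .pair hM' hN'⟩
    | .arr A B =>
      have hv : ReadBack true (A :: Θ) (.var 0) (.var 0) A := .var rfl
      obtain ⟨M, hM, hM'⟩ := RC.reify B
        (h (A :: Θ) Nat.succ (.succ Θ A) (.var 0) (.var 0) (.var 0) (.var 0) (RC.reflect A hv hv))
      exact ⟨_, .lam hM, .lam hM'⟩
end

/-! ## The fundamental lemma -/

/-- Related substitutions by stoup-free terms. -/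
structure Env (Γ : List VType) (Θ : List STy) (γ γ' : ℕ → Tm) : Prop where
  left : ∀ n, StoupFree (γ n)
  right : ∀ n, StoupFree (γ' n)
  rel : ∀ n A, Γ[n]? = some A → RV A Θ (γ n) (γ' n)

namespace Env

variable {Γ : List VType} {Θ : List STy} {γ γ' : ℕ → Tm}

theorem symm (h : Env Γ Θ γ γ') : Env Γ Θ γ' γ :=
  ⟨h.right, h.left, fun n A hA => RV.symm A (h.rel n A hA)⟩

theorem refl_right (h : Env Γ Θ γ γ') : Env Γ Θ γ' γ' :=
  ⟨h.right, h.right, fun n A hA => RV.trans A (h.symm.rel n A hA) (h.rel n A hA)⟩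

theorem mono (h : Env Γ Θ γ γ') {f : ℕ → ℕ} {Θ' : List STy} (hf : Renaming f Θ Θ') :
    Env Γ Θ' (Tm.rename f ∘ γ) (Tm.rename f ∘ γ') :=
  ⟨fun n => (h.left n).rename f, fun n => (h.right n).rename f,
    fun n A hA => RV.mono A hf (h.rel n A hA)⟩

theorem cons (h : Env Γ Θ γ γ') {A : VType} {a a' : Tm} (ha : StoupFree a) (ha' : StoupFree a')
    (hr : RV A Θ a a') : Env (A :: Γ) Θ (Tm.cons a γ) (Tm.cons a' γ') := by
  refine ⟨StoupFree.cons ha h.left, StoupFree.cons ha' h.right, ?_⟩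
  rintro (_ | n) B hB
  · obtain rfl : A = B := by simpa using hB
    exact hr
  · exact h.rel n B (by simpa using hB)

end Env

/-- Related substituends for the stoup. -/
def Stp : Option CType → List STy → Tm → Tm → Prop
  | none => fun _ _ _ => True
  | some A => RC A

namespace Stp

variable {Δ : Option CType} {Θ : List STy} {b b' : Tm}

theorem symm (h : Stp Δ Θ b b') : Stp Δ Θ b' b := by
  cases Δ
  · trivial
  · exact RC.symm _ h

theorem refl_right (h : Stp Δ Θ b b') : Stp Δ Θ b' b' := by
  cases Δ
  · trivial
  · exact RC.trans _ (RC.symm _ h) h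

theorem mono (h : Stp Δ Θ b b') {f : ℕ → ℕ} {Θ' : List STy} (hf : Renaming f Θ Θ') :
    Stp Δ Θ' (b.rename f) (b'.rename f) := by
  cases Δ
  · trivial
  · exact RC.mono _ hf h

end Stp

/-- Semantic equality of open EEC terms: related substitutions give related instances. -/
def Sem (Γ : List VType) (Δ : Option CType) (t t' : Tm) (A : VType) : Prop :=
  ∀ Θ γ γ' b b', Env Γ Θ γ γ' → Stp Δ Θ b b' → RV A Θ (msub γ b t) (msub γ' b' t')

namespace Sem

variable {Γ : List VType} {Δ : Option CType} {s s' t t' u u' v : Tm} {A B : VType}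
  {C D E : CType}

theorem symm (h : Sem Γ Δ t u A) : Sem Γ Δ u t A := fun Θ γ γ' b b' hγ hb =>
  RV.symm A (h Θ γ' γ b' b hγ.symm hb.symm)

theorem trans (h : Sem Γ Δ t u A) (h' : Sem Γ Δ u v A) : Sem Γ Δ t v A :=
  fun Θ γ γ' b b' hγ hb => RV.trans A (h Θ γ γ' b b' hγ hb)
    (h' Θ γ' γ' b' b' hγ.refl_right hb.refl_right)

theorem vpair (h : Sem Γ none t t' A) (h' : Sem Γ none u u' B) :
    Sem Γ none (.vpair t u) (.vpair t' u') (.prod A B) := fun Θ γ γ' b b' hγ hb =>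
  ⟨RV.expand A (.single (.vfst_beta _ _)) (.single (.vfst_beta _ _)) (h Θ γ γ' b b' hγ hb),
    RV.expand B (.single (.vsnd_beta _ _)) (.single (.vsnd_beta _ _)) (h' Θ γ γ' b b' hγ hb)⟩

theorem vlam (h : Sem (A :: Γ) none t t' B) :
    Sem Γ none (.vlam A t) (.vlam A t') (.arr A B) := by
  intro Θ γ γ' b b' hγ _ Θ' f hf a a' ha ha' hr
  have hγ := hγ.mono hf
  rw [rename_msub, rename_msub]
  refine RV.expand B (.single (.vapp_beta _ _ _)) (.single (.vapp_beta _ _ _)) ?_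
  rw [subst0_msub hγ.left, subst0_msub hγ.right]
  exact h _ _ _ _ _ (hγ.cons ha ha' hr) trivial

theorem vapp (hu : StoupFree u) (hu' : StoupFree u') (h : Sem Γ none t t' (.arr A B))
    (h' : Sem Γ none u u' A) : Sem Γ none (.vapp t u) (.vapp t' u') B := by
  intro Θ γ γ' b b' hγ hb
  have := h Θ γ γ' b b' hγ hb Θ id (.id Θ) _ _ (hu.msub hγ.left b) (hu'.msub hγ.right b')
    (h' Θ γ γ' b b' hγ hb)
  simp only [rename_id] at this
  exact this

theorem cpair (h : Sem Γ Δ t t' (.comp C)) (h' : Sem Γ Δ u u' (.comp D)) :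
    Sem Γ Δ (.cpair t u) (.cpair t' u') (.comp (.cand C D)) := fun Θ γ γ' b b' hγ hb =>
  ⟨RC.expand C (.single (.cfst_beta _ _)) (.single (.cfst_beta _ _)) (h Θ γ γ' b b' hγ hb),
    RC.expand D (.single (.csnd_beta _ _)) (.single (.csnd_beta _ _)) (h' Θ γ γ' b b' hγ hb)⟩

theorem clam (h : Sem (A :: Γ) Δ t t' (.comp C)) :
    Sem Γ Δ (.clam A t) (.clam A t') (.comp (.carr A C)) := by
  intro Θ γ γ' b b' hγ hb Θ' f hf a a' ha ha' hr
  have hγ := hγ.mono hf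
  rw [rename_msub, rename_msub]
  refine RC.expand C (.single (.capp_beta _ _ _)) (.single (.capp_beta _ _ _)) ?_
  rw [subst0_msub hγ.left, subst0_msub hγ.right]
  exact h _ _ _ _ _ (hγ.cons ha ha' hr) (hb.mono hf)

theorem capp (hu : StoupFree u) (hu' : StoupFree u') (h : Sem Γ Δ t t' (.comp (.carr A C)))
    (h' : Sem Γ none u u' A) : Sem Γ Δ (.capp t u) (.capp t' u') (.comp C) := by
  intro Θ γ γ' b b' hγ hb
  have := h Θ γ γ' b b' hγ hb Θ id (.id Θ) _ _ (hu.msub hγ.left b) (hu'.msub hγ.right b')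
    (h' Θ γ γ' b b' hγ trivial)
  simp only [rename_id] at this
  exact this

theorem ilet (h : Sem Γ Δ t t' (.comp .iunit)) (h' : Sem Γ none u u' (.comp C)) :
    Sem Γ Δ (.ilet t u) (.ilet t' u') (.comp C) := by
  intro Θ γ γ' b b' hγ hb
  obtain ⟨h₁, h₂⟩ := h Θ γ γ' b b' hγ hb
  exact RC.expand C ((h₁.lift (Tm.ilet · _) fun _ _ => .ilet _).tail (.ilet_beta _))
    ((h₂.lift (Tm.ilet · _) fun _ _ => .ilet _).tail (.ilet_beta _)) (h' Θ γ γ' b b' hγ trivial)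

theorem bang (ht : StoupFree t) (ht' : StoupFree t') (h : Sem Γ none t t' A) :
    Sem Γ none (.bang t) (.bang t') (.comp (.bang A)) := fun Θ γ γ' b b' hγ hb =>
  ⟨_, _, .refl, .refl, ht.msub hγ.left b, ht'.msub hγ.right b', h Θ γ γ' b b' hγ hb⟩

theorem steps_banglet {γ : ℕ → Tm} {b a : Tm} (hγ : ∀ n, StoupFree (γ n))
    (h : Steps (msub γ b t) (.bang a)) :
    Steps (msub γ b (.banglet t u)) (msub (cons a γ) b u) := by
  rw [← subst0_msub hγ]
  exact (h.lift (Tm.banglet · _) fun _ _ => .banglet _).tail (.banglet_beta _ _)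

theorem steps_copowlet {γ : ℕ → Tm} {b a c : Tm} (hγ : ∀ n, StoupFree (γ n)) (ha : StoupFree a)
    (h : Steps (msub γ b t) (.copow a c)) :
    Steps (msub γ b (.copowlet t u)) (msub (cons a γ) c u) := by
  have : ssubst c (subst0 a (msub (liftS γ) .svar u)) = msub (cons a γ) c u := by
    rw [subst0_msub_svar hγ, ssubst_msub (StoupFree.cons ha hγ)]
    rfl
  rw [← this]
  exact (h.lift (Tm.copowlet · _) fun _ _ => .copowlet _).tail (.copowlet_beta _ _ _)

theorem steps_ccase_inl {γ : ℕ → Tm} {b c : Tm} (hγ : ∀ n, StoupFree (γ n))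
    (h : Steps (msub γ b s) (.cinl c)) : Steps (msub γ b (.ccase s t u)) (msub γ c t) := by
  have : ssubst c (msub γ .svar t) = msub γ c t := ssubst_msub hγ ..
  rw [← this]
  exact (h.lift (Tm.ccase · _ _) fun _ _ => .ccase _ _).tail (.ccase_inl _ _ _)

theorem steps_ccase_inr {γ : ℕ → Tm} {b c : Tm} (hγ : ∀ n, StoupFree (γ n))
    (h : Steps (msub γ b s) (.cinr c)) : Steps (msub γ b (.ccase s t u)) (msub γ c u) := by
  have : ssubst c (msub γ .svar u) = msub γ c u := ssubst_msub hγ ..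
  rw [← this]
  exact (h.lift (Tm.ccase · _ _) fun _ _ => .ccase _ _).tail (.ccase_inr _ _ _)

theorem banglet (h : Sem Γ Δ t t' (.comp (.bang A))) (h' : Sem (A :: Γ) none u u' (.comp C)) :
    Sem Γ Δ (.banglet t u) (.banglet t' u') (.comp C) := by
  intro Θ γ γ' b b' hγ hb
  obtain ⟨a, a', h₁, h₂, ha, ha', hr⟩ := h Θ γ γ' b b' hγ hb
  exact RC.expand C (steps_banglet hγ.left h₁) (steps_banglet hγ.right h₂)
    (h' _ _ _ _ _ (hγ.cons ha ha' hr) trivial)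

theorem copow (ht : StoupFree t) (ht' : StoupFree t') (h : Sem Γ none t t' A)
    (h' : Sem Γ Δ u u' (.comp C)) :
    Sem Γ Δ (.copow t u) (.copow t' u') (.comp (.copow A C)) := fun Θ γ γ' b b' hγ hb =>
  ⟨_, _, _, _, .refl, .refl, ht.msub hγ.left b, ht'.msub hγ.right b',
    h Θ γ γ' b b' hγ trivial, h' Θ γ γ' b b' hγ hb⟩

theorem copowlet (h : Sem Γ Δ t t' (.comp (.copow A C)))
    (h' : Sem (A :: Γ) (some C) u u' (.comp D)) :
    Sem Γ Δ (.copowlet t u) (.copowlet t' u') (.comp D) := by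
  intro Θ γ γ' b b' hγ hb
  obtain ⟨a, a', c, c', h₁, h₂, ha, ha', hr, hc⟩ := h Θ γ γ' b b' hγ hb
  exact RC.expand D (steps_copowlet hγ.left ha h₁) (steps_copowlet hγ.right ha' h₂)
    (h' _ _ _ _ _ (hγ.cons ha ha' hr) hc)

theorem cimage (h : Sem Γ Δ t t' (.comp .czero)) (u u' : Tm) : Sem Γ Δ u u' A :=
  fun Θ γ γ' b b' hγ hb => (h Θ γ γ' b b' hγ hb).elim

theorem cinl (h : Sem Γ Δ t t' (.comp C)) :
    Sem Γ Δ (.cinl t) (.cinl t') (.comp (.csum C D)) := fun Θ γ γ' b b' hγ hb =>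
  .inl ⟨_, _, .refl, .refl, h Θ γ γ' b b' hγ hb⟩

theorem cinr (h : Sem Γ Δ t t' (.comp D)) :
    Sem Γ Δ (.cinr t) (.cinr t') (.comp (.csum C D)) := fun Θ γ γ' b b' hγ hb =>
  .inr ⟨_, _, .refl, .refl, h Θ γ γ' b b' hγ hb⟩

theorem ccase (h : Sem Γ Δ s s' (.comp (.csum C D))) (h₁ : Sem Γ (some C) t t' (.comp E))
    (h₂ : Sem Γ (some D) u u' (.comp E)) :
    Sem Γ Δ (.ccase s t u) (.ccase s' t' u') (.comp E) := by
  intro Θ γ γ' b b' hγ hb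
  rcases h Θ γ γ' b b' hγ hb with ⟨c, c', h, h', hr⟩ | ⟨c, c', h, h', hr⟩
  · exact RC.expand E (steps_ccase_inl hγ.left h) (steps_ccase_inl hγ.right h')
      (h₁ _ _ _ _ _ hγ hr)
  · exact RC.expand E (steps_ccase_inr hγ.left h) (steps_ccase_inr hγ.right h')
      (h₂ _ _ _ _ _ hγ hr)

theorem llam (h : Sem Γ (some C) t t' (.comp D)) :
    Sem Γ none (.llam C t) (.llam C t') (.lin C D) := by
  intro Θ γ γ' b b' hγ _ Θ' f hf a a' hr
  have hγ := hγ.mono hf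
  rw [rename_msub, rename_msub]
  refine RC.expand D (.single (.lapp_beta _ _ _)) (.single (.lapp_beta _ _ _)) ?_
  rw [ssubst_msub hγ.left, ssubst_msub hγ.right]
  exact h _ _ _ _ _ hγ hr

theorem lapp (h : Sem Γ none t t' (.lin C D)) (h' : Sem Γ Δ u u' (.comp C)) :
    Sem Γ Δ (.lapp t u) (.lapp t' u') (.comp D) := by
  intro Θ γ γ' b b' hγ hb
  have := h Θ γ γ' b b' hγ trivial Θ id (.id Θ) _ _ (h' Θ γ γ' b b' hγ hb)
  simp only [rename_id] at this
  exact this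

theorem ssubst_right {Θ : List STy} {γ γ' : ℕ → Tm} {b' c : Tm}
    (h : Sem Γ (some C) u u' B) (hγ : Env Γ Θ γ γ') (hc : RC C Θ c (msub γ' b' t)) :
    RV B Θ (msub γ c u) (msub γ' b' (ssubst t u')) := by
  rw [msub_ssubst]
  exact h _ _ _ _ _ hγ hc

/-- Head expansion on the left-hand side of a semantic equation. -/
theorem expand_left (h : Sem Γ Δ t u A)
    (hs : ∀ γ b, (∀ n, StoupFree (γ n)) → Step (msub γ b s) (msub γ b t)) : Sem Γ Δ s u A :=
  fun Θ γ γ' b b' hγ hb => RV.expand A (.single (hs γ b hγ.left)) .refl (h Θ γ γ' b b' hγ hb)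

end Sem

theorem Deriv.sem {Γ Δ t A} (d : Deriv Γ Δ t A) : Sem Γ Δ t t A := by
  induction d with
  | var _ n A h => exact fun Θ γ γ' b b' hγ hb => hγ.rel n A h
  | svar => exact fun Θ γ γ' b b' hγ hb => hb
  | unit => exact fun _ _ _ _ _ _ _ => trivial
  | vpair _ _ _ _ _ _ _ h1 h2 => exact h1.vpair h2
  | vfst _ _ _ _ _ h => exact fun Θ γ γ' b b' hγ hb => (h Θ γ γ' b b' hγ hb).1
  | vsnd _ _ _ _ _ h => exact fun Θ γ γ' b b' hγ hb => (h Θ γ γ' b b' hγ hb).2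
  | vlam _ _ _ _ _ h => exact h.vlam
  | vapp _ _ _ _ _ _ e h1 h2 => exact h1.vapp e.stoupFree e.stoupFree h2
  | cunit => exact fun _ _ _ _ _ _ _ => trivial
  | cpair _ _ _ _ _ _ _ _ h1 h2 => exact h1.cpair h2
  | cfst _ _ _ _ _ _ h => exact fun Θ γ γ' b b' hγ hb => (h Θ γ γ' b b' hγ hb).1
  | csnd _ _ _ _ _ _ h => exact fun Θ γ γ' b b' hγ hb => (h Θ γ γ' b b' hγ hb).2
  | clam _ _ _ _ _ _ h => exact h.clam
  | capp _ _ _ _ _ _ _ e h1 h2 => exact h1.capp e.stoupFree e.stoupFree h2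
  | top => exact fun _ _ _ _ _ _ _ => ⟨.refl, .refl⟩
  | ilet _ _ _ _ _ _ _ h1 h2 => exact h1.ilet h2
  | bang _ _ _ e h => exact h.bang e.stoupFree e.stoupFree
  | banglet _ _ _ _ _ _ _ _ h1 h2 => exact h1.banglet h2
  | copow _ _ _ _ _ _ e _ h1 h2 => exact h1.copow e.stoupFree e.stoupFree h2
  | copowlet _ _ _ _ _ _ _ _ _ h1 h2 => exact h1.copowlet h2
  | cimage _ _ _ _ _ h => exact h.cimage _ _
  | cinl _ _ _ _ _ _ h => exact h.cinl
  | cinr _ _ _ _ _ _ h => exact h.cinr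
  | ccase _ _ _ _ _ _ _ _ _ _ _ h1 h2 h3 => exact h1.ccase h2 h3
  | llam _ _ _ _ _ h => exact h.llam
  | lapp _ _ _ _ _ _ _ _ h1 h2 => exact h1.lapp h2

theorem EEq.sem {Γ Δ t u A} (h : EEq Γ Δ t u A) : Sem Γ Δ t u A := by
  induction h with
  | refl d => exact d.sem
  | symm _ h => exact h.symm
  | trans _ _ h1 h2 => exact h1.trans h2
  | vpair_cong _ _ h1 h2 => exact h1.vpair h2
  | vfst_cong _ h => exact fun Θ γ γ' b b' hγ hb => (h Θ γ γ' b b' hγ hb).1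
  | vsnd_cong _ h => exact fun Θ γ γ' b b' hγ hb => (h Θ γ γ' b b' hγ hb).2
  | vlam_cong _ h => exact h.vlam
  | vapp_cong _ e h1 h2 => exact h1.vapp e.deriv.1.some.stoupFree e.deriv.2.some.stoupFree h2
  | cpair_cong _ _ h1 h2 => exact h1.cpair h2
  | cfst_cong _ h => exact fun Θ γ γ' b b' hγ hb => (h Θ γ γ' b b' hγ hb).1
  | csnd_cong _ h => exact fun Θ γ γ' b b' hγ hb => (h Θ γ γ' b b' hγ hb).2
  | clam_cong _ h => exact h.clam
  | capp_cong _ e h1 h2 => exact h1.capp e.deriv.1.some.stoupFree e.deriv.2.some.stoupFree h2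
  | ilet_cong _ _ h1 h2 => exact h1.ilet h2
  | bang_cong e h => exact h.bang e.deriv.1.some.stoupFree e.deriv.2.some.stoupFree
  | banglet_cong _ _ h1 h2 => exact h1.banglet h2
  | copow_cong e _ h1 h2 => exact h1.copow e.deriv.1.some.stoupFree e.deriv.2.some.stoupFree h2
  | copowlet_cong _ _ h1 h2 => exact h1.copowlet h2
  | cimage_cong _ h => exact h.cimage _ _
  | cinl_cong _ h => exact h.cinl
  | cinr_cong _ h => exact h.cinr
  | ccase_cong _ _ _ h1 h2 h3 => exact h1.ccase h2 h3
  | llam_cong _ h => exact h.llam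
  | lapp_cong _ _ h1 h2 => exact h1.lapp h2
  | unit_eta => exact fun _ _ _ _ _ _ _ => trivial
  | cunit_eta => exact fun _ _ _ _ _ _ _ => trivial
  | vfst_beta d _ => exact d.sem.expand_left fun _ _ _ => .vfst_beta _ _
  | vsnd_beta _ e => exact e.sem.expand_left fun _ _ _ => .vsnd_beta _ _
  | cfst_beta d _ => exact d.sem.expand_left fun _ _ _ => .cfst_beta _ _
  | csnd_beta _ e => exact e.sem.expand_left fun _ _ _ => .csnd_beta _ _
  | ilet_beta d => exact d.sem.expand_left fun _ _ _ => .ilet_beta _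
  | vpair_eta d =>
    intro Θ γ γ' b b' hγ hb
    have := d.sem Θ γ γ' b b' hγ hb
    exact ⟨RV.expand _ (.single (.vfst_beta _ _)) .refl this.1,
      RV.expand _ (.single (.vsnd_beta _ _)) .refl this.2⟩
  | cpair_eta d =>
    intro Θ γ γ' b b' hγ hb
    have := d.sem Θ γ γ' b b' hγ hb
    exact ⟨RC.expand _ (.single (.cfst_beta _ _)) .refl this.1,
      RC.expand _ (.single (.csnd_beta _ _)) .refl this.2⟩
  | vlam_beta d e =>
    refine (d.subst0 e).some.sem.expand_left fun γ b hγ => ?_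
    rw [msub_subst0 _ _ e.stoupFree, ← subst0_msub hγ]
    exact .vapp_beta _ _ _
  | clam_beta d e =>
    refine (d.subst0 e).some.sem.expand_left fun γ b hγ => ?_
    rw [msub_subst0 _ _ e.stoupFree, ← subst0_msub hγ]
    exact .capp_beta _ _ _
  | bang_beta d e =>
    refine (e.subst0 d).some.sem.expand_left fun γ b hγ => ?_
    rw [msub_subst0 _ _ d.stoupFree, ← subst0_msub hγ]
    exact .banglet_beta _ _
  | @llam_beta _ _ t u _ _ d e =>
    refine (d.ssubst e).some.sem.expand_left fun γ b hγ => ?_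
    have : Tm.ssubst (msub γ b u) (msub γ .svar t) = msub γ (msub γ b u) t := ssubst_msub hγ ..
    rw [msub_ssubst, ← this]
    exact .lapp_beta _ _ _
  | csum_beta_inl d e f =>
    intro Θ γ γ' b b' hγ hb
    refine RC.expand _ (Sem.steps_ccase_inl hγ.left .refl) .refl ?_
    exact d.sem.ssubst_right hγ (f.sem Θ γ γ' b b' hγ hb)
  | csum_beta_inr d e f =>
    intro Θ γ γ' b b' hγ hb
    refine RC.expand _ (Sem.steps_ccase_inr hγ.left .refl) .refl ?_
    exact e.sem.ssubst_right hγ (f.sem Θ γ γ' b b' hγ hb)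
  | copow_beta d e f =>
    intro Θ γ γ' b b' hγ hb
    refine RC.expand _ (Sem.steps_copowlet hγ.left (d.stoupFree.msub hγ.left b) .refl) .refl ?_
    have := ((f.subst0 d).some.ssubst e).some.sem Θ γ γ' b b' hγ hb
    rwa [msub_ssubst, msub_subst0 _ _ d.stoupFree, d.stoupFree, ← d.stoupFree γ b] at this
  | @vlam_eta _ t A _ d =>
    intro Θ γ γ' b b' hγ hb Θ' f hf a a' ha ha' hr
    refine RV.expand _ (.single ?_) .refl (d.sem Θ γ γ' b b' hγ hb Θ' f hf a a' ha ha' hr)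
    rw [rename_msub, rename_msub]
    have : Tm.subst0 a (msub (liftS (Tm.rename f ∘ γ)) (shift (b.rename f)) (.vapp (shift t) (.var 0)))
        = .vapp (msub (Tm.rename f ∘ γ) (b.rename f) t) a := by
      rw [subst0_msub (hγ.mono hf).left]
      exact congrArg (Tm.vapp · a) (msub_cons_shift _ _ _ _)
    rw [← this]
    exact .vapp_beta _ _ _
  | @clam_eta _ _ t A _ d =>
    intro Θ γ γ' b b' hγ hb Θ' f hf a a' ha ha' hr
    refine RC.expand _ (.single ?_) .refl (d.sem Θ γ γ' b b' hγ hb Θ' f hf a a' ha ha' hr)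
    rw [rename_msub, rename_msub]
    have : Tm.subst0 a (msub (liftS (Tm.rename f ∘ γ)) (shift (b.rename f)) (.capp (shift t) (.var 0)))
        = .capp (msub (Tm.rename f ∘ γ) (b.rename f) t) a := by
      rw [subst0_msub (hγ.mono hf).left]
      exact congrArg (Tm.capp · a) (msub_cons_shift _ _ _ _)
    rw [← this]
    exact .capp_beta _ _ _
  | @llam_eta _ t A _ d =>
    intro Θ γ γ' b b' hγ hb Θ' f hf a a' hr
    refine RC.expand _ (.single ?_) .refl (d.sem Θ γ γ' b b' hγ hb Θ' f hf a a' hr)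
    rw [rename_msub, rename_msub]
    have : Tm.ssubst a (msub (Tm.rename f ∘ γ) .svar (.lapp t .svar))
        = .lapp (msub (Tm.rename f ∘ γ) (b.rename f) t) a := by
      rw [ssubst_msub (hγ.mono hf).left, d.stoupFree _ (b.rename f)]
      exact congrArg (Tm.lapp · a) (d.stoupFree _ _)
    rw [← this]
    exact .lapp_beta _ _ _
  | ilet_eta d e =>
    intro Θ γ γ' b b' hγ hb
    obtain ⟨h₁, h₂⟩ := d.sem Θ γ γ' b b' hγ hb
    refine RC.expand _ ((h₁.lift (Tm.ilet · _) fun _ _ => .ilet _).tail (.ilet_beta _)) .refl ?_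
    rw [msub_ssubst]
    exact e.sem.ssubst_right hγ ⟨.refl, h₂⟩
  | bang_eta d e =>
    intro Θ γ γ' b b' hγ hb
    obtain ⟨a, a', h₁, h₂, r⟩ := d.sem Θ γ γ' b b' hγ hb
    refine RC.expand _ (Sem.steps_banglet hγ.left h₁) .refl ?_
    rw [msub_ssubst, msub_cons_shift]
    exact e.sem.ssubst_right hγ ⟨a, a', .refl, h₂, r⟩
  | copow_eta d e =>
    intro Θ γ γ' b b' hγ hb
    obtain ⟨a, a', c, c', h₁, h₂, ha, r⟩ := d.sem Θ γ γ' b b' hγ hb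
    refine RC.expand _ (Sem.steps_copowlet hγ.left ha h₁) .refl ?_
    rw [msub_ssubst, msub_cons_shift]
    exact e.sem.ssubst_right hγ ⟨a, a', c, c', .refl, h₂, ha, r⟩
  | czero_eta d _ => exact d.sem.cimage _ _
  | csum_eta d e =>
    intro Θ γ γ' b b' hγ hb
    rcases d.sem Θ γ γ' b b' hγ hb with ⟨c, c', h, h', hr⟩ | ⟨c, c', h, h', hr⟩
    · refine RC.expand _ (Sem.steps_ccase_inl hγ.left h) .refl ?_
      rw [msub_ssubst]
      exact e.sem.ssubst_right hγ (.inl ⟨c, c', .refl, h', hr⟩)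
    · refine RC.expand _ (Sem.steps_ccase_inr hγ.left h) .refl ?_
      rw [msub_ssubst]
      exact e.sem.ssubst_right hγ (.inr ⟨c, c', .refl, h', hr⟩)

/-- The identity substitution is related to itself over the translation of a context. -/
theorem Env.var (Θ : List STy) : Env (cbnCtx Θ) Θ .var .var := by
  refine ⟨.var, .var, fun n A hA => ?_⟩
  obtain ⟨B, hB, rfl⟩ : ∃ B, Θ[n]? = some B ∧ VType.comp (cbnT B) = A := by
    simpa [cbnCtx] using hA
  exact RC.reflect B (.var hB) (.var hB)

/-- Terms which are semantically equal over a translated context have a common read-back. -/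
theorem Sem.readBack {Θ t u A} (h : Sem (cbnCtx Θ) none t u (.comp (cbnT A))) :
    ∃ M, ReadBack false Θ t M A ∧ ReadBack false Θ u M A := by
  have := h Θ .var .var .svar .svar (.var Θ) trivial
  rw [msub_var_svar, msub_var_svar] at this
  exact RC.reify A this

/-- **Soundness and full completeness of the call-by-name translation into
EEC** (Proposition 3.3): (1) if `Θ ⊢ M =_{βη} N : τ` then
`Θⁿ ⊢ Mⁿ = Nⁿ : τⁿ` in the equational theory of EEC; (2) conversely for
well-typed `M`, `N`; (3) every EEC term `Θⁿ ⊢ t : τⁿ` is equal to the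
translation `Mⁿ` of some simply-typed term `Θ ⊢ M : τ`. -/
theorem cbn_sound_fully_complete :
    (∀ (Θ : List STy) (M N : LTm) (τ : STy),
      LBetaEta Θ M N τ →
      EEq (cbnCtx Θ) none (cbnTm M) (cbnTm N) (.comp (cbnT τ))) ∧
    (∀ (Θ : List STy) (M N : LTm) (τ : STy),
      Nonempty (LDeriv Θ M τ) → Nonempty (LDeriv Θ N τ) →
      EEq (cbnCtx Θ) none (cbnTm M) (cbnTm N) (.comp (cbnT τ)) →
      LBetaEta Θ M N τ) ∧
    (∀ (Θ : List STy) (τ : STy) (t : Tm),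
      Nonempty (Deriv (cbnCtx Θ) none t (.comp (cbnT τ))) →
      ∃ M : LTm, Nonempty (LDeriv Θ M τ) ∧
        EEq (cbnCtx Θ) none (cbnTm M) t (.comp (cbnT τ))) := by
  refine ⟨fun Θ M N τ h => h.cbn, fun Θ M N τ ⟨d⟩ ⟨e⟩ h => ?_, fun Θ τ t ⟨d⟩ => ?_⟩
  · obtain ⟨P, hM, hN⟩ := h.sem.readBack
    exact (hM.lBetaEta d rfl fun _ => rfl).2.trans (hN.lBetaEta e rfl fun _ => rfl).2.symm
  · obtain ⟨M, hM, -⟩ := d.sem.readBack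
    exact ⟨M, (hM.eEq d fun _ => rfl).2⟩

end EEC
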